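/- Let H = kQ be a representation-finite hereditary algebra over an algebraically closed field whose underlying graph is the Dynkin diagram A_n (n ≥ 1). Then the nilpotency index of the radical of mod H equals n. -/

import Mathlib

open CategoryTheory
open scoped Classical

/-! ## Quiver combinatorics -/

/-- Paths in a quiver given by source and target maps. -/
inductive QPath {V E : Type} (src tgt : E → V) : V → V → Type
  | nil (a : V) : QPath src tgt a a
  | cons {a b : V} (p : QPath src tgt a b) (α : E) (h : src α = b) : QPath src tgt a (tgt α)

namespace QPath

variable {V E : Type} {src tgt : E → V}

def length : ∀ {a b : V}, QPath src tgt a b → ℕ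
  | _, _, .nil _ => 0
  | _, _, .cons p _ _ => p.length + 1

def comp : ∀ {a b c : V}, QPath src tgt a b → QPath src tgt b c → QPath src tgt a c
  | _, _, _, p, .nil _ => p
  | _, _, _, p, .cons q α h => .cons (p.comp q) α h

/-- The list of vertices visited by a path, in order. -/
def verts : ∀ {a b : V}, QPath src tgt a b → List V
  | a, _, .nil _ => [a]
  | _, _, .cons p α _ => p.verts ++ [tgt α]

/-- The interior (intermediate) vertices of a path. -/
def interior {a b : V} (p : QPath src tgt a b) : List V :=
  (p.verts.dropLast).drop 1

/-- The list of arrows of a path, in walk order. -/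
def arrows : ∀ {a b : V}, QPath src tgt a b → List E
  | _, _, .nil _ => []
  | _, _, .cons p α _ => p.arrows ++ [α]

end QPath

/-- A presentation of the algebra `A` by the (ordinary) quiver with vertex set `V`
and arrow set `E` : a complete family of orthogonal primitive idempotents indexed by
the vertices together with generators indexed by the arrows. -/
structure QuiverPresentation (k A V E : Type) [Field k] [Ring A] [Algebra k A]
    [Fintype V] [Fintype E] where
  src : E → V
  tgt : E → V
  idem : V → A
  arrow : E → A
  idem_idem : ∀ a : V, idem a * idem a = idem a
  idem_orth : ∀ a b : V, a ≠ b → idem a * idem b = 0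
  sum_idem : ∑ a : V, idem a = 1
  idem_ne : ∀ a : V, idem a ≠ 0
  idem_primitive : ∀ (v : V) (f g : A), f * f = f → g * g = g → f * g = 0 → g * f = 0 →
    f + g = idem v → f = 0 ∨ g = 0
  arrow_mem : ∀ α : E, idem (tgt α) * arrow α * idem (src α) = arrow α
  arrow_ne : ∀ α : E, arrow α ≠ 0
  generates : Algebra.adjoin k (Set.range idem ∪ Set.range arrow) = ⊤

namespace QuiverPresentation

variable {k A V E : Type} [Field k] [Ring A] [Algebra k A] [Fintype V] [Fintype E]

/-- The product in `A` of the arrows along a path (paths are written right to left). -/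
def qprod (P : QuiverPresentation k A V E) :
    ∀ {a b : V}, QPath P.src P.tgt a b → A
  | _, _, .nil a => P.idem a
  | _, _, .cons p α _ => P.arrow α * P.qprod p

/-- The ideal of relations is admissible: all sufficiently long paths vanish. -/
def Admissible (P : QuiverPresentation k A V E) : Prop :=
  ∃ N : ℕ, ∀ (a b : V) (p : QPath P.src P.tgt a b), N ≤ p.length → P.qprod p = 0

/-- The presentation is minimal: the idempotents and the arrows are linearly
independent modulo the span of the products of paths of length at least two,
so that `(V, E)` really is the ordinary quiver of `A`. -/
def Minimal (P : QuiverPresentation k A V E) : Prop :=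
  ∀ (c : V → k) (d : E → k),
    ((∑ a : V, c a • P.idem a) + ∑ α : E, d α • P.arrow α) ∈
      Submodule.span k {x : A | ∃ (a b : V) (p : QPath P.src P.tgt a b),
        2 ≤ p.length ∧ P.qprod p = x} →
    (∀ a, c a = 0) ∧ (∀ α, d α = 0)

/-- The algebra is monomial: the ideal of relations is generated by paths; equivalently,
the images of the paths which do not vanish are linearly independent. -/
def Monomial (P : QuiverPresentation k A V E) : Prop :=
  LinearIndependent k
    (fun q : {q : Σ a : V, Σ b : V, QPath P.src P.tgt a b // P.qprod q.2.2 ≠ 0} =>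
      P.qprod q.1.2.2)

/-- A (minimal) zero-relation: a path of length at least two whose product vanishes
while the product along every proper subpath does not. -/
def IsZeroRel (P : QuiverPresentation k A V E) {a b : V} (p : QPath P.src P.tgt a b) : Prop :=
  P.qprod p = 0 ∧ 2 ≤ p.length ∧
  ∀ (x y : V) (q : QPath P.src P.tgt x y) (p₁ : QPath P.src P.tgt a x)
    (p₂ : QPath P.src P.tgt y b),
      p = p₁.comp (q.comp p₂) → q.length < p.length → P.qprod q ≠ 0

/-- A vertex `u` is involved in a zero-relation `α_m ⋯ α_1` if `u = s(α_i)`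
for some `i = 2, …, m`, i.e. `u` is an interior vertex of the relation. -/
def InvolvedInZeroRel (P : QuiverPresentation k A V E) (u : V) : Prop :=
  ∃ (a b : V) (p : QPath P.src P.tgt a b), P.IsZeroRel p ∧ u ∈ p.interior

/-! ### Walks (for strings and for connectivity) -/

/-- The starting vertex of a step (an arrow traversed forwards or backwards). -/
def stepSrc (P : QuiverPresentation k A V E) (s : E × Bool) : V :=
  if s.2 then P.src s.1 else P.tgt s.1

/-- The ending vertex of a step. -/
def stepTgt (P : QuiverPresentation k A V E) (s : E × Bool) : V :=
  if s.2 then P.tgt s.1 else P.src s.1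

/-- `l` is a walk from `a` to `b` in the underlying graph of the quiver. -/
def IsWalkFrom (P : QuiverPresentation k A V E) : V → List (E × Bool) → V → Prop
  | a, [], b => a = b
  | a, s :: l, b => P.stepSrc s = a ∧ P.IsWalkFrom (P.stepTgt s) l b

/-- The product in `A` of a list of arrows (listed in walk order). -/
def wprod (P : QuiverPresentation k A V E) (l : List E) : A :=
  ((l.map P.arrow).reverse).prod

/-- A reduced walk: no step is immediately followed by its inverse. -/
def Reduced (l : List (E × Bool)) : Prop :=
  ¬ ∃ (l₁ : List (E × Bool)) (s : E × Bool) (l₂ : List (E × Bool)),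
      l = l₁ ++ s :: (s.1, !s.2) :: l₂

/-- No direct subwalk of `l` nor the inverse of such lies in the ideal of relations. -/
def NoZeroSub (P : QuiverPresentation k A V E) (l : List (E × Bool)) : Prop :=
  ∀ (l₁ : List (E × Bool)) (r : List E) (l₂ : List (E × Bool)),
    (l = l₁ ++ (r.map (fun e => (e, true))) ++ l₂ → P.wprod r ≠ 0) ∧
    (l = l₁ ++ (r.map (fun e => (e, false))) ++ l₂ → P.wprod r.reverse ≠ 0)

/-- A string from `a` to `b`. -/
def IsStringWalk (P : QuiverPresentation k A V E) (a : V) (l : List (E × Bool)) (b : V) : Prop :=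
  P.IsWalkFrom a l b ∧ Reduced l ∧ P.NoZeroSub l

/-- `(Q_u^s)_0` : the strings starting at `u` that are trivial or start with an arrow. -/
def QSset (P : QuiverPresentation k A V E) (u : V) : Set (List (E × Bool)) :=
  {l | ∃ b : V, P.IsStringWalk u l b ∧ (l = [] ∨ ∃ (α : E) (l' : List (E × Bool)),
    l = (α, true) :: l')}

/-- `(Q_u^e)_0` : the strings ending at `u` that are trivial or end with an arrow. -/
def QEset (P : QuiverPresentation k A V E) (u : V) : Set (List (E × Bool)) :=
  {l | ∃ a : V, P.IsStringWalk a l u ∧ (l = [] ∨ ∃ (α : E) (l' : List (E × Bool)),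
    l = l' ++ [(α, true)])}

/-- `S_γ` : the strings starting with the arrow `γ`. -/
def Sarr (P : QuiverPresentation k A V E) (γ : E) : Set (List (E × Bool)) :=
  {l | ∃ b : V, P.IsStringWalk (P.src γ) l b ∧ ∃ l' : List (E × Bool), l = (γ, true) :: l'}

/-- `E_γ` : the strings ending with the arrow `γ`. -/
def Earr (P : QuiverPresentation k A V E) (γ : E) : Set (List (E × Bool)) :=
  {l | ∃ a : V, P.IsStringWalk a l (P.tgt γ) ∧ ∃ l' : List (E × Bool), l = l' ++ [(γ, true)]}

/-- The defining conditions of a string algebra. -/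
def IsStringAlgebra (P : QuiverPresentation k A V E) : Prop :=
  P.Monomial ∧
  (∀ v : V, Nat.card {α : E // P.src α = v} ≤ 2) ∧
  (∀ v : V, Nat.card {α : E // P.tgt α = v} ≤ 2) ∧
  (∀ γ : E, Nat.card {β : E // P.src β = P.tgt γ ∧ P.arrow β * P.arrow γ ≠ 0} ≤ 1) ∧
  (∀ β : E, Nat.card {γ : E // P.src β = P.tgt γ ∧ P.arrow β * P.arrow γ ≠ 0} ≤ 1)

/-- Connectivity in the underlying graph, avoiding a given set of arrows. -/
def ConnAvoid (P : QuiverPresentation k A V E) (avoid : Set E) (a b : V) : Prop :=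
  ∃ l : List (E × Bool), P.IsWalkFrom a l b ∧ ∀ s ∈ l, s.1 ∉ avoid

def Connected (P : QuiverPresentation k A V E) : Prop := ∀ a b : V, P.ConnAvoid ∅ a b

/-- The underlying graph of the quiver is a tree. -/
def IsTreeQuiver (P : QuiverPresentation k A V E) : Prop :=
  P.Connected ∧ Fintype.card E + 1 = Fintype.card V

/-- The underlying (undirected) graph of the quiver is given by the edge-endpoint
specification `ends` on `nV` vertices and `nE` edges. -/
def GraphSpec (P : QuiverPresentation k A V E) (nV nE : ℕ) (ends : Fin nE → ℕ × ℕ) : Prop :=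
  ∃ (v : Fin nV ≃ V) (ar : Fin nE ≃ E), ∀ i : Fin nE, ∃ a b : Fin nV,
    (a : ℕ) = (ends i).1 ∧ (b : ℕ) = (ends i).2 ∧
    ((P.src (ar i) = v a ∧ P.tgt (ar i) = v b) ∨ (P.src (ar i) = v b ∧ P.tgt (ar i) = v a))

/-- The directed quiver is given by the arrow specification `ends`. -/
def DirGraphSpec (P : QuiverPresentation k A V E) (nV nE : ℕ) (ends : Fin nE → ℕ × ℕ) : Prop :=
  ∃ (v : Fin nV ≃ V) (ar : Fin nE ≃ E), ∀ i : Fin nE, ∃ a b : Fin nV,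
    (a : ℕ) = (ends i).1 ∧ (b : ℕ) = (ends i).2 ∧
    P.src (ar i) = v a ∧ P.tgt (ar i) = v b

/-- The underlying graph of the full subquiver on vertices `S` and arrows `T`. -/
def SubGraphSpec (P : QuiverPresentation k A V E) (S : Set V) (T : Set E)
    (nV nE : ℕ) (ends : Fin nE → ℕ × ℕ) : Prop :=
  ∃ (v : Fin nV ≃ S) (ar : Fin nE ≃ T), ∀ i : Fin nE, ∃ a b : Fin nV,
    (a : ℕ) = (ends i).1 ∧ (b : ℕ) = (ends i).2 ∧
    ((P.src (ar i) = v a ∧ P.tgt (ar i) = v b) ∨ (P.src (ar i) = v b ∧ P.tgt (ar i) = v a))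

end QuiverPresentation

/-- Edge endpoints of the Dynkin graph `A_n`. -/
def typeAEnds (n : ℕ) : Fin (n - 1) → ℕ × ℕ := fun i => ((i : ℕ), (i : ℕ) + 1)

/-- Edge endpoints of the Dynkin graph `D_n`. -/
def typeDEnds (n : ℕ) : Fin (n - 1) → ℕ × ℕ := fun i =>
  if (i : ℕ) = 0 then (0, 2) else if (i : ℕ) = 1 then (1, 2) else ((i : ℕ), (i : ℕ) + 1)

/-- Edge endpoints of the Dynkin graph `E_m` for `m = 6, 7, 8`. -/
def typeEEnds (m : ℕ) : Fin (m - 1) → ℕ × ℕ := fun i =>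
  if (i : ℕ) = m - 2 then (2, m - 1) else ((i : ℕ), (i : ℕ) + 1)

/-! ## The module category, its radical and the nilpotency index -/

section ModuleSide

variable (A : Type) [Ring A]

/-- An indecomposable module: non-zero, with no non-trivial idempotent endomorphism. -/
def Indec (M : ModuleCat.{0} A) : Prop :=
  Nontrivial M ∧ ∀ f : M ⟶ M, f ≫ f = f → f = 0 ∨ f = 𝟙 M

/-- A finitely generated indecomposable module. -/
def FinIndec (M : ModuleCat.{0} A) : Prop := Module.Finite A M ∧ Indec A M

/-- `A` is representation-finite: finitely many finitely generated indecomposables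
up to isomorphism. -/
def RepFinite : Prop :=
  ∃ (n : ℕ) (T : Fin n → ModuleCat.{0} A),
    ∀ M : ModuleCat.{0} A, FinIndec A M → ∃ i, Nonempty (M ≅ T i)

/-- `A` is (left) hereditary. -/
def Hereditary : Prop := ∀ I : Submodule A A, Module.Projective A I

/-- An irreducible morphism: it does not split, and in any factorization one of
the factors splits. -/
def IrredMor {X Y : ModuleCat.{0} A} (f : X ⟶ Y) : Prop :=
  (¬ ∃ g : Y ⟶ X, f ≫ g = 𝟙 X) ∧ (¬ ∃ g : Y ⟶ X, g ≫ f = 𝟙 Y) ∧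
  ∀ (Z : ModuleCat.{0} A), Module.Finite A Z → ∀ (u : X ⟶ Z) (v : Z ⟶ Y), f = u ≫ v →
    (∃ r : Z ⟶ X, u ≫ r = 𝟙 X) ∨ (∃ s : Y ⟶ Z, s ≫ v = 𝟙 Y)

/-- The radical of `Hom(X, Y)`. -/
def radSet (X Y : ModuleCat.{0} A) : Set (X ⟶ Y) :=
  {f | ∀ M : ModuleCat.{0} A, FinIndec A M →
    ∀ (h : M ⟶ X) (h' : Y ⟶ M), ¬ IsIso (h ≫ f ≫ h')}

/-- Compositions of `n` radical morphisms. -/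
def radPowSet : ℕ → ∀ (X Y : ModuleCat.{0} A), Set (X ⟶ Y)
  | 0, _, _ => Set.univ
  | n + 1, X, Y => {f | ∃ (M : ModuleCat.{0} A) (g : X ⟶ M) (h : M ⟶ Y),
      Module.Finite A M ∧ g ∈ radSet A X M ∧ h ∈ radPowSet n M Y ∧ f = g ≫ h}

/-- The `n`-th power of the radical of `mod A` vanishes. -/
def RadVanishes (n : ℕ) : Prop :=
  ∀ X Y : ModuleCat.{0} A, Module.Finite A X → Module.Finite A Y →
    ∀ f ∈ radPowSet A n X Y, f = 0

/-- `m` is the nilpotency index of the radical of `mod A`. -/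
def NilpotencyIndex (m : ℕ) : Prop :=
  1 ≤ m ∧ RadVanishes A m ∧ ∀ l : ℕ, RadVanishes A l → m ≤ l

/-- A path of irreducible morphisms between (f.g.) indecomposable modules,
together with its composite morphism and its length. -/
inductive IrrPath : ∀ (M N : ModuleCat.{0} A), (M ⟶ N) → ℕ → Prop
  | nil (M : ModuleCat.{0} A) : FinIndec A M → IrrPath M M (𝟙 M) 0
  | cons {M X N : ModuleCat.{0} A} (f : M ⟶ X) (g : X ⟶ N) (n : ℕ) :
      FinIndec A M → IrredMor A f → IrrPath X N g n → IrrPath M N (f ≫ g) (n + 1)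

/-- The Auslander–Reiten quiver of `A` is a component with length : parallel paths
of irreducible morphisms have the same length. -/
def WithLength : Prop :=
  ∀ (M N : ModuleCat.{0} A) (n m : ℕ),
    (∃ f : M ⟶ N, IrrPath A M N f n) → (∃ g : M ⟶ N, IrrPath A M N g m) → n = m

/-- `N` is a successor of `M` (a path of non-zero morphisms between f.g.
indecomposables from `M` to `N`). -/
inductive Reach : ModuleCat.{0} A → ModuleCat.{0} A → Prop
  | refl (M : ModuleCat.{0} A) : FinIndec A M → Reach M M
  | cons {M X N : ModuleCat.{0} A} : FinIndec A M → FinIndec A X →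
      (∃ f : M ⟶ X, f ≠ 0) → Reach X N → Reach M N

/-- `N` is a direct summand of `M`. -/
def IsSummand (N M : ModuleCat.{0} A) : Prop :=
  ∃ (i : N ⟶ M) (p : M ⟶ N), i ≫ p = 𝟙 N

/-- The radical of a module (intersection of the maximal submodules). -/
def radOf (M : ModuleCat.{0} A) : Submodule A M := sInf {N | IsCoatom N}

/-- The socle of a module (sum of the simple submodules). -/
def socOf (M : ModuleCat.{0} A) : Submodule A M := sSup {N | IsAtom N}

/-- `0 → X → E → Y → 0` is an almost split (Auslander–Reiten) sequence. -/
def IsAlmostSplit {X E Y : ModuleCat.{0} A} (f : X ⟶ E) (g : E ⟶ Y) : Prop :=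
  FinIndec A X ∧ FinIndec A Y ∧ Module.Finite A E ∧
  Function.Injective f ∧ Function.Surjective g ∧
  (∀ x : X, g (f x) = 0) ∧ (∀ e : E, g e = 0 → ∃ x : X, f x = e) ∧
  (¬ ∃ s : Y ⟶ E, s ≫ g = 𝟙 Y) ∧
  (∀ (M : ModuleCat.{0} A) (h : X ⟶ M), (¬ ∃ r : M ⟶ X, h ≫ r = 𝟙 X) →
    ∃ t : E ⟶ M, f ≫ t = h) ∧
  (∀ (M : ModuleCat.{0} A) (h : M ⟶ Y), (¬ ∃ s : Y ⟶ M, s ≫ h = 𝟙 Y) →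
    ∃ t : M ⟶ E, t ≫ g = h)

/-- `X = τ Y` : there is an almost split sequence `0 → X → E → Y → 0`. -/
def IsTauOf (X Y : ModuleCat.{0} A) : Prop :=
  ∃ (E : ModuleCat.{0} A) (f : X ⟶ E) (g : E ⟶ Y), IsAlmostSplit A f g

/-- A sectional path of irreducible morphisms of length `n` from `M` to `N`. -/
def SectionalPath (M N : ModuleCat.{0} A) (n : ℕ) : Prop :=
  ∃ Y : Fin (n + 1) → ModuleCat.{0} A,
    Y 0 = M ∧ Y (Fin.last n) = N ∧ (∀ i, FinIndec A (Y i)) ∧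
    (∀ i : Fin n, ∃ f : Y i.castSucc ⟶ Y i.succ, IrredMor A f) ∧
    ∀ (i : ℕ) (h : i + 2 ≤ n),
      ¬ IsTauOf A (Y ⟨i, by omega⟩) (Y ⟨i + 2, by omega⟩)

end ModuleSide

/-! ## Modules attached to vertices -/

section Vertices

variable {k A V E : Type} [Field k] [Ring A] [Algebra k A] [Fintype V] [Fintype E]

/-- `S` is the simple module at the vertex `a`. -/
def IsSimpleAt (P : QuiverPresentation k A V E) (a : V) (S : ModuleCat.{0} A) : Prop :=
  IsSimpleModule A S ∧ ∃ x : S, P.idem a • x ≠ 0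

/-- `Pm` is the indecomposable projective at the vertex `a`. -/
def IsProjAt (P : QuiverPresentation k A V E) (a : V) (Pm : ModuleCat.{0} A) : Prop :=
  Module.Projective A Pm ∧ FinIndec A Pm ∧
  ∃ (S : ModuleCat.{0} A) (f : Pm ⟶ S), IsSimpleAt P a S ∧ Function.Surjective f

/-- `Im` is the indecomposable injective at the vertex `a`. -/
def IsInjAt (P : QuiverPresentation k A V E) (a : V) (Im : ModuleCat.{0} A) : Prop :=
  Module.Injective A Im ∧ FinIndec A Im ∧
  ∃ (S : ModuleCat.{0} A) (f : S ⟶ Im), IsSimpleAt P a S ∧ Function.Injective f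

/-- `RVal P a n` : `n` is the length of a non-zero path of irreducible morphisms
between indecomposable modules from `P_a` to `I_a` going through `S_a`. -/
def RVal (P : QuiverPresentation k A V E) (a : V) (n : ℕ) : Prop :=
  ∃ (Pm S Im : ModuleCat.{0} A) (f : Pm ⟶ S) (g : S ⟶ Im) (n₁ n₂ : ℕ),
    IsProjAt P a Pm ∧ IsSimpleAt P a S ∧ IsInjAt P a Im ∧
    IrrPath A Pm S f n₁ ∧ IrrPath A S Im g n₂ ∧ f ≫ g ≠ 0 ∧ n = n₁ + n₂

end Vertices

/-! ## Hereditary algebras with a linear quiver -/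

/-- Over a hereditary ring, right multiplication by `a = e * a ≠ 0`, with `e` a primitive
idempotent, is injective on `A e`. -/
theorem Hereditary.eq_zero_of_mul_eq_zero {A : Type} [Ring A] (hher : Hereditary A) {e a : A}
    (he : e * e = e)
    (hprim : ∀ f g : A, f * f = f → g * g = g → f * g = 0 → g * f = 0 → f + g = e →
      f = 0 ∨ g = 0)
    (hea : e * a = a) (ha : a ≠ 0) {x : A} (hx : x * e = x) (h : x * a = 0) : x = 0 := by
  set φ : A →ₗ[A] A := LinearMap.toSpanSingleton A A a with hφ
  have hφx : ∀ y, φ y = y * a := fun y => by simp [hφ]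
  have : Module.Projective A (LinearMap.range φ) := hher _
  obtain ⟨s, hs⟩ := Module.projective_lifting_property φ.rangeRestrict LinearMap.id
    φ.surjective_rangeRestrict
  set u : A := s (φ.rangeRestrict 1) with hu
  have hmul : ∀ y : A, y * u = s (φ.rangeRestrict y) := fun y => by
    rw [hu, ← smul_eq_mul, ← map_smul, ← map_smul, smul_eq_mul, mul_one]
  have hua : u * a = a := by
    have h1 := LinearMap.congr_fun hs (φ.rangeRestrict 1)
    have h2 := congrArg Subtype.val h1
    simpa [hφx, ← hu] using h2
  have hzero : ∀ y : A, y * a = 0 → y * u = 0 := fun y hy => by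
    have : φ.rangeRestrict y = 0 := Subtype.ext (by simp [hφx, hy])
    rw [hmul, this, map_zero]
  have huu : u * u = u := by
    have := hzero (u - 1) (by rw [sub_mul, hua, one_mul, sub_self])
    rwa [sub_mul, one_mul, sub_eq_zero] at this
  have heu : e * u = u := by
    have := hzero (e - 1) (by rw [sub_mul, hea, one_mul, sub_self])
    rwa [sub_mul, one_mul, sub_eq_zero] at this
  have hff : (u * e) * (u * e) = u * e := by
    rw [mul_assoc, ← mul_assoc e, heu, ← mul_assoc, huu]
  have hef : e * (u * e) = u * e := by rw [← mul_assoc, heu]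
  have hfe : (u * e) * e = u * e := by rw [mul_assoc, he]
  rcases hprim (u * e) (e - u * e) hff
      (by simp only [sub_mul, mul_sub, hff, hef, hfe, he]; abel)
      (by rw [mul_sub, hff, hfe, sub_self]) (by rw [sub_mul, hff, hef, sub_self])
      (by abel) with h0 | h0
  · exact absurd (by rw [← hua, ← hea, ← mul_assoc, h0, zero_mul]) ha
  · rw [sub_eq_zero] at h0
    rw [← hx, h0, ← mul_assoc, hzero x h, zero_mul]

/-- The source of the `i`-th edge of a linear graph, oriented by `o`. -/
def lineSrc (o : ℕ → Bool) (i : ℕ) : ℕ := if o i then i else i + 1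

/-- The target of the `i`-th edge of a linear graph, oriented by `o`. -/
def lineTgt (o : ℕ → Bool) (i : ℕ) : ℕ := if o i then i + 1 else i

/-- An algebra presented by a linear quiver with vertices `0, …, n - 1` in which right
multiplication by an arrow is injective; the edge `i` joins `i` and `i + 1`. -/
structure LineData (k A : Type) [Field k] [Ring A] [Algebra k A] (n : ℕ) where
  e : ℕ → A
  a : ℕ → A
  o : ℕ → Bool
  e_mul_self : ∀ i, e i * e i = e i
  e_mul_ne : ∀ i j, i ≠ j → e i * e j = 0
  sum_e : ∑ i ∈ Finset.range n, e i = 1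
  e_ne : ∀ i, i < n → e i ≠ 0
  e_zero : ∀ i, n ≤ i → e i = 0
  a_zero : ∀ i, n ≤ i + 1 → a i = 0
  tgt_mul : ∀ i, e (lineTgt o i) * a i = a i
  mul_src : ∀ i, a i * e (lineSrc o i) = a i
  cancel : ∀ i, i + 1 < n → ∀ x, x * e (lineTgt o i) = x → x * a i = 0 → x = 0
  gen : Algebra.adjoin k (Set.range e ∪ Set.range a) = ⊤

theorem QuiverPresentation.exists_lineData {k A V E : Type} [Field k] [Ring A] [Algebra k A]
    [Fintype V] [Fintype E] (P : QuiverPresentation k A V E) (hher : Hereditary A) (n : ℕ)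
    (hgraph : P.GraphSpec n (n - 1) (typeAEnds n)) : Nonempty (LineData k A n) := by
  obtain ⟨v, ar, h⟩ := hgraph
  set e : ℕ → A := fun i => if h : i < n then P.idem (v ⟨i, h⟩) else 0 with he
  set a : ℕ → A := fun i => if h : i < n - 1 then P.arrow (ar ⟨i, h⟩) else 0 with ha
  set o : ℕ → Bool := fun i => if h : i < n - 1 then
    decide (P.src (ar ⟨i, h⟩) = v ⟨i, by omega⟩) else true with ho
  have hst : ∀ i (hi : i < n - 1), ∃ (hs : lineSrc o i < n) (ht : lineTgt o i < n),
      P.src (ar ⟨i, hi⟩) = v ⟨_, hs⟩ ∧ P.tgt (ar ⟨i, hi⟩) = v ⟨_, ht⟩ := by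
    intro i hi
    have hi0 : i < n := by omega
    have hi1 : i + 1 < n := by omega
    obtain ⟨x, y, hx, hy, hxy⟩ := h ⟨i, hi⟩
    simp only [typeAEnds] at hx hy
    obtain rfl : x = ⟨i, hi0⟩ := Fin.ext hx
    obtain rfl : y = ⟨i + 1, hi1⟩ := Fin.ext hy
    by_cases hc : P.src (ar ⟨i, hi⟩) = v ⟨i, by omega⟩
    · have hoi : o i = true := by simp [ho, hi, hc]
      simp only [lineSrc, lineTgt, hoi, if_true]
      rcases hxy with hxy | hxy
      · exact ⟨by omega, by omega, hxy⟩
      · have := v.injective (hc.symm.trans hxy.1)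
        simp at this
    · have hoi : o i = false := by simp [ho, hi, hc]
      simp only [lineSrc, lineTgt, hoi]
      rcases hxy with hxy | hxy
      · exact absurd hxy.1 hc
      · exact ⟨by simp; omega, by simp; omega, by simpa using hxy⟩
  have hei : ∀ i (hi : i < n), e i = P.idem (v ⟨i, hi⟩) := fun i hi => by simp [he, hi]
  have hai : ∀ i (hi : i < n - 1), a i = P.arrow (ar ⟨i, hi⟩) := fun i hi => by simp [ha, hi]
  have htm : ∀ i, e (lineTgt o i) * a i = a i := by
    intro i
    by_cases hi : i < n - 1
    · obtain ⟨hs, ht, hs', ht'⟩ := hst i hi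
      rw [hei _ ht, ← ht', hai i hi]
      conv_lhs => rw [← P.arrow_mem]
      rw [mul_assoc, ← mul_assoc (P.idem _), P.idem_idem, ← mul_assoc, P.arrow_mem]
    · simp [ha, hi]
  have hms : ∀ i, a i * e (lineSrc o i) = a i := by
    intro i
    by_cases hi : i < n - 1
    · obtain ⟨hs, ht, hs', ht'⟩ := hst i hi
      rw [hei _ hs, ← hs', hai i hi]
      conv_lhs => rw [← P.arrow_mem]
      rw [mul_assoc, P.idem_idem, P.arrow_mem]
    · simp [ha, hi]
  refine ⟨⟨e, a, o, ?_, ?_, ?_, ?_, ?_, ?_, htm, hms, ?_, ?_⟩⟩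
  · intro i
    by_cases hi : i < n
    · rw [hei i hi, P.idem_idem]
    · simp [he, hi]
  · intro i j hij
    by_cases hi : i < n
    · by_cases hj : j < n
      · rw [hei i hi, hei j hj, P.idem_orth]
        intro hv
        exact hij (by simpa using v.injective hv)
      · simp [he, hj]
    · simp [he, hi]
  · rw [Finset.sum_range, ← P.sum_idem, ← v.sum_comp]
    exact Finset.sum_congr rfl fun i _ => hei i i.2
  · intro i hi
    rw [hei i hi]
    exact P.idem_ne _
  · intro i hi
    simp [he, hi]
  · intro i hi
    have : ¬ i < n - 1 := by omega
    simp [ha, this]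
  · intro i hi x hx hxa
    obtain ⟨hs, ht, hs', ht'⟩ := hst i (by omega)
    refine hher.eq_zero_of_mul_eq_zero (e := e (lineTgt o i)) (a := a i) ?_ ?_ (htm i) ?_ hx hxa
    · rw [hei _ ht, P.idem_idem]
    · rw [hei _ ht]
      exact P.idem_primitive _
    · rw [hai i (by omega)]
      exact P.arrow_ne _
  · rw [eq_top_iff, ← P.generates]
    refine Algebra.adjoin_mono (Set.union_subset_union ?_ ?_)
    · rintro _ ⟨x, rfl⟩
      exact ⟨v.symm x, by rw [hei _ (v.symm x).2]; simp⟩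
    · rintro _ ⟨x, rfl⟩
      exact ⟨ar.symm x, by rw [hai _ (ar.symm x).2]; simp⟩

namespace LineData

variable {k A : Type} [Field k] [Ring A] [Algebra k A] {n : ℕ} (D : LineData k A n)

/-- `D.IsPath i j x`: `x` is the product of the arrows along a directed path from `j` to `i`. -/
inductive IsPath : ℕ → ℕ → A → Prop
  | nil (i : ℕ) (hi : i < n) : IsPath i i (D.e i)
  | cons {i l j : ℕ} {x : A} (m : ℕ) (hm : m + 1 < n) (hi : i = lineTgt D.o m)
      (hl : l = lineSrc D.o m) (h : IsPath l j x) : IsPath i j (D.a m * x)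

namespace IsPath

variable {D} {i j l : ℕ} {x y : A}

theorem lt_left (h : D.IsPath i j x) : i < n := by
  cases h with
  | nil i hi => exact hi
  | cons m hm hi hl h => rw [hi, lineTgt]; split_ifs <;> omega

theorem oriented (h : D.IsPath i j x) :
    (j ≤ i ∧ ∀ m, j ≤ m → m < i → D.o m = true) ∨
      (i ≤ j ∧ ∀ m, i ≤ m → m < j → D.o m = false) := by
  induction h with
  | nil i hi => exact Or.inl ⟨le_rfl, fun m _ _ => by omega⟩
  | @cons i l j x m hm hi hl h ih =>
    cases hom : D.o m
    · simp only [lineTgt, lineSrc, hom] at hi hl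
      simp only [Bool.false_eq_true, if_false] at hi hl
      subst hi hl
      have key : i + 1 ≤ j ∧ ∀ m, i + 1 ≤ m → m < j → D.o m = false := by
        rcases ih with ⟨h1, h2⟩ | h1
        · by_cases hj : j = i + 1
          · exact ⟨by omega, fun m _ _ => by omega⟩
          · have := h2 i (by omega) (by omega)
            simp [hom] at this
        · exact h1
      refine Or.inr ⟨by omega, fun m h1 h2 => ?_⟩
      rcases Nat.eq_or_lt_of_le h1 with rfl | h3
      · exact hom
      · exact key.2 m h3 h2
    · simp only [lineTgt, lineSrc, hom, if_true] at hi hl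
      subst hi hl
      have key : j ≤ l ∧ ∀ m, j ≤ m → m < l → D.o m = true := by
        rcases ih with h1 | ⟨h1, h2⟩
        · exact h1
        · by_cases hj : j = l
          · exact ⟨by omega, fun m _ _ => by omega⟩
          · have := h2 l (by omega) (by omega)
            simp [hom] at this
      refine Or.inl ⟨by omega, fun m h1 h2 => ?_⟩
      rcases Nat.eq_or_lt_of_le (Nat.le_of_lt_succ h2) with rfl | h3
      · exact hom
      · exact key.2 m h1 h3

/-- Directed paths stay inside an interval containing their end points. -/
theorem mem_Icc (h : D.IsPath i l x) (h' : D.IsPath l j y) {a b : ℕ} (hi : i ∈ Finset.Icc a b)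
    (hj : j ∈ Finset.Icc a b) : l ∈ Finset.Icc a b := by
  rw [Finset.mem_Icc] at *
  constructor
  · by_contra! hl
    rcases h.oriented with h1 | h1 <;> rcases h'.oriented with h2 | h2
    · omega
    · have e1 := h1.2 l (by omega) (by omega)
      have e2 := h2.2 l (by omega) (by omega)
      simp [e1] at e2
    · omega
    · omega
  · by_contra! hl
    rcases h.oriented with h1 | h1 <;> rcases h'.oriented with h2 | h2
    · omega
    · omega
    · have e1 := h1.2 (l - 1) (by omega) (by omega)
      have e2 := h2.2 (l - 1) (by omega) (by omega)
      simp [e1] at e2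
    · omega

theorem ne_tgt {m : ℕ} (h : D.IsPath (lineSrc D.o m) (lineTgt D.o m) x) : False := by
  have := h.oriented
  cases hom : D.o m
  · simp only [lineTgt, lineSrc, hom, Bool.false_eq_true, if_false] at this
    rcases this with h1 | h1
    · have := h1.2 m (by omega) (by omega)
      simp [hom] at this
    · omega
  · simp only [lineTgt, lineSrc, hom, if_true] at this
    rcases this with h1 | h1
    · omega
    · have := h1.2 m (by omega) (by omega)
      simp [hom] at this

theorem unique (h : D.IsPath i j x) (h' : D.IsPath i j y) : x = y := by
  induction h generalizing y with
  | nil i hi =>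
    cases h' with
    | nil => rfl
    | cons m hm hi hl h => subst hi hl; exact h.ne_tgt.elim
  | cons m hm hi hl h ih =>
    cases h' with
    | nil => subst hi hl; exact h.ne_tgt.elim
    | @cons _ l' _ y m' hm' hi' hl' h' =>
      have hmm : m = m' := by
        have h1 := h.oriented
        have h2 := h'.oriented
        grind [lineSrc, lineTgt]
      subst hmm hl hl'
      rw [ih h']

theorem e_mul (h : D.IsPath i j x) : D.e i * x = x := by
  cases h with
  | nil => exact D.e_mul_self i
  | cons m hm hi hl h => rw [hi, ← mul_assoc, D.tgt_mul]

theorem comp (h : D.IsPath i l x) (h' : D.IsPath l j y) : D.IsPath i j (x * y) := by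
  induction h with
  | nil i hi => rwa [h'.e_mul]
  | cons m hm hi hl h ih => rw [mul_assoc]; exact (ih h').cons m hm hi hl

theorem eq_zero_of_mul (h : D.IsPath i j x) {z : A} (hz : z * D.e i = z) (hzx : z * x = 0) :
    z = 0 := by
  induction h generalizing z with
  | nil i hi => rw [← hz, hzx]
  | cons m hm hi hl h ih =>
    subst hi hl
    refine D.cancel m hm z hz (ih ?_ ?_)
    · rw [mul_assoc, D.mul_src]
    · rw [mul_assoc, hzx]

theorem ne_zero (h : D.IsPath i j x) : x ≠ 0 := fun hx =>
  D.e_ne i h.lt_left (h.eq_zero_of_mul (D.e_mul_self i) (by rw [hx, mul_zero]))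

end IsPath

/-- The product of the arrows along the directed path from `j` to `i`, or `0` without such. -/
noncomputable def path (i j : ℕ) : A := if h : ∃ x, D.IsPath i j x then h.choose else 0

variable {D} in
theorem IsPath.path_eq {i j : ℕ} {x : A} (h : D.IsPath i j x) : D.path i j = x := by
  have h' : ∃ x, D.IsPath i j x := ⟨x, h⟩
  rw [path, dif_pos h']
  exact h'.choose_spec.unique h

theorem isPath_path {i j : ℕ} (h : D.path i j ≠ 0) : D.IsPath i j (D.path i j) := by
  by_cases h' : ∃ x, D.IsPath i j x
  · obtain ⟨x, hx⟩ := h'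
    rwa [hx.path_eq]
  · exact absurd (by rw [path, dif_neg h']) h

theorem path_self {i : ℕ} (hi : i < n) : D.path i i = D.e i := (IsPath.nil i hi).path_eq

theorem path_arrow {m : ℕ} (hm : m + 1 < n) :
    D.path (lineTgt D.o m) (lineSrc D.o m) = D.a m := by
  have hs : lineSrc D.o m < n := by rw [lineSrc]; split_ifs <;> omega
  have := (IsPath.cons m hm rfl rfl (IsPath.nil (D := D) _ hs)).path_eq
  rwa [D.mul_src] at this

theorem path_mul {i l j : ℕ} (h : D.path i l ≠ 0) (h' : D.path l j ≠ 0) :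
    D.path i l * D.path l j = D.path i j :=
  ((D.isPath_path h).comp (D.isPath_path h')).path_eq.symm

theorem path_ne {i l j : ℕ} (h : D.path i l ≠ 0) (h' : D.path l j ≠ 0) : D.path i j ≠ 0 := by
  have hp := (D.isPath_path h).comp (D.isPath_path h')
  rw [hp.path_eq]
  exact hp.ne_zero

theorem corner_mul (x y : A) (i j : ℕ) : D.e i * (x * y) * D.e j =
    ∑ l ∈ Finset.range n, (D.e i * x * D.e l) * (D.e l * y * D.e j) := by
  calc D.e i * (x * y) * D.e j
      = D.e i * x * (∑ l ∈ Finset.range n, D.e l) * (y * D.e j) := by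
        rw [D.sum_e, mul_one]; simp only [mul_assoc]
    _ = _ := by
      rw [Finset.mul_sum, Finset.sum_mul]
      refine Finset.sum_congr rfl fun l _ => ?_
      rw [mul_assoc (D.e l), ← mul_assoc _ (D.e l), mul_assoc _ (D.e l) (D.e l), D.e_mul_self]

/-- The corners of the algebra are spanned by paths. -/
theorem exists_corner (x : A) : ∀ i j, ∃ c : k, D.e i * x * D.e j = c • D.path i j := by
  have hx : x ∈ Algebra.adjoin k (Set.range D.e ∪ Set.range D.a) := by rw [D.gen]; trivial
  have hscal : ∀ (r : k) (i j : ℕ), ∃ c : k, D.e i * (algebraMap k A r) * D.e j =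
      c • D.path i j := by
    intro r i j
    by_cases hij : i = j
    · subst hij
      by_cases hi : i < n
      · refine ⟨r, ?_⟩
        rw [D.path_self hi, ← Algebra.commutes, mul_assoc, D.e_mul_self, Algebra.smul_def]
      · exact ⟨0, by simp [D.e_zero i (not_lt.1 hi)]⟩
    · exact ⟨0, by rw [← Algebra.commutes, mul_assoc, D.e_mul_ne i j hij]; simp⟩
  induction hx using Algebra.adjoin_induction with
  | mem x hx =>
    intro i j
    rcases hx with ⟨m, rfl⟩ | ⟨m, rfl⟩
    · by_cases hij : i = m ∧ m = j
      · obtain ⟨rfl, rfl⟩ := hij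
        simpa [D.e_mul_self] using hscal 1 i i
      · refine ⟨0, ?_⟩
        rcases not_and_or.1 hij with h | h
        · rw [D.e_mul_ne _ _ h]; simp
        · rw [mul_assoc, D.e_mul_ne _ _ h]; simp
    · by_cases hm : m + 1 < n
      · by_cases hij : i = lineTgt D.o m ∧ lineSrc D.o m = j
        · obtain ⟨rfl, rfl⟩ := hij
          exact ⟨1, by rw [D.path_arrow hm, D.tgt_mul, D.mul_src, one_smul]⟩
        · refine ⟨0, ?_⟩
          rcases not_and_or.1 hij with h | h
          · rw [← D.tgt_mul m, ← mul_assoc, D.e_mul_ne _ _ h]; simp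
          · rw [← D.mul_src m, mul_assoc, mul_assoc, D.e_mul_ne _ _ h]; simp
      · exact ⟨0, by rw [D.a_zero m (not_lt.1 hm)]; simp⟩
  | algebraMap r => exact hscal r
  | add x y _ _ hx hy =>
    intro i j
    obtain ⟨c, hc⟩ := hx i j
    obtain ⟨d, hd⟩ := hy i j
    exact ⟨c + d, by rw [mul_add, add_mul, hc, hd, add_smul]⟩
  | mul x y _ _ hx hy =>
    intro i j
    choose c hc using hx
    choose d hd using hy
    refine ⟨∑ l ∈ Finset.range n,
      if D.path i l ≠ 0 ∧ D.path l j ≠ 0 then c i l * d l j else 0, ?_⟩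
    rw [D.corner_mul, Finset.sum_smul]
    refine Finset.sum_congr rfl fun l _ => ?_
    rw [hc, hd, smul_mul_smul_comm]
    split_ifs with h
    · rw [D.path_mul h.1 h.2]
    · rw [zero_smul]
      rcases not_and_or.1 h with h | h
      · rw [not_not.1 h, zero_mul, smul_zero]
      · rw [not_not.1 h, mul_zero, smul_zero]

/-- The coefficient of `x` at the path from `j` to `i`. -/
noncomputable def coef (x : A) (i j : ℕ) : k :=
  if D.path i j = 0 then 0 else (D.exists_corner x i j).choose

theorem coef_spec (x : A) (i j : ℕ) : D.e i * x * D.e j = D.coef x i j • D.path i j := by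
  rw [coef]
  split_ifs with h
  · obtain ⟨c, hc⟩ := D.exists_corner x i j
    rw [hc, h, smul_zero, smul_zero]
  · exact (D.exists_corner x i j).choose_spec

theorem path_ne_of_coef_ne {x : A} {i j : ℕ} (h : D.coef x i j ≠ 0) : D.path i j ≠ 0 := by
  contrapose! h
  rw [coef, if_pos h]

theorem coef_eq {x : A} {i j : ℕ} {c : k} (h : D.e i * x * D.e j = c • D.path i j)
    (hc : D.path i j = 0 → c = 0) : D.coef x i j = c := by
  by_cases hp : D.path i j = 0
  · rw [coef, if_pos hp, hc hp]
  · rw [D.coef_spec, ← sub_eq_zero, ← sub_smul, smul_eq_zero] at h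
    exact sub_eq_zero.1 (h.resolve_right hp)

theorem coef_add (x y : A) (i j : ℕ) : D.coef (x + y) i j = D.coef x i j + D.coef y i j := by
  refine D.coef_eq ?_ fun h => ?_
  · rw [mul_add, add_mul, D.coef_spec, D.coef_spec, add_smul]
  · simp [coef, h]

theorem coef_algebraMap (r : k) {i j : ℕ} (hi : i < n) :
    D.coef (algebraMap k A r) i j = if i = j then r else 0 := by
  split_ifs with hij
  · subst hij
    refine D.coef_eq ?_ fun h => ?_
    · rw [D.path_self hi, ← Algebra.commutes, mul_assoc, D.e_mul_self, Algebra.smul_def]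
    · exact absurd (D.path_self hi ▸ h) (D.e_ne i hi)
  · refine D.coef_eq ?_ fun _ => rfl
    rw [← Algebra.commutes, mul_assoc, D.e_mul_ne i j hij]; simp

theorem coef_e {i j m : ℕ} (hi : i < n) :
    D.coef (D.e m) i j = if i = m ∧ j = m then 1 else 0 := by
  split_ifs with hij
  · obtain ⟨rfl, rfl⟩ := hij
    refine D.coef_eq ?_ fun h => ?_
    · rw [D.path_self hi, D.e_mul_self, D.e_mul_self, one_smul]
    · exact absurd (D.path_self hi ▸ h) (D.e_ne _ hi)
  · refine D.coef_eq ?_ fun _ => rfl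
    rcases not_and_or.1 hij with h | h
    · rw [D.e_mul_ne _ _ h]; simp
    · rw [mul_assoc, D.e_mul_ne _ _ (Ne.symm h)]; simp

theorem coef_a {i j m : ℕ} (hm : m + 1 < n) :
    D.coef (D.a m) i j = if i = lineTgt D.o m ∧ j = lineSrc D.o m then 1 else 0 := by
  split_ifs with hij
  · obtain ⟨rfl, rfl⟩ := hij
    refine D.coef_eq (by rw [D.path_arrow hm, D.tgt_mul, D.mul_src, one_smul]) fun h => ?_
    have hs : lineSrc D.o m < n := by rw [lineSrc]; split_ifs <;> omega
    have := IsPath.cons m hm rfl rfl (IsPath.nil (D := D) _ hs)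
    exact absurd h (this.path_eq ▸ this.ne_zero)
  · refine D.coef_eq ?_ fun _ => rfl
    rcases not_and_or.1 hij with h | h
    · rw [← D.tgt_mul m, ← mul_assoc, D.e_mul_ne _ _ h]; simp
    · rw [← D.mul_src m, mul_assoc, mul_assoc, D.e_mul_ne _ _ (Ne.symm h)]; simp

theorem coef_mul (x y : A) {a b i j : ℕ} (hb : b < n) (hi : i ∈ Finset.Icc a b)
    (hj : j ∈ Finset.Icc a b) :
    D.coef (x * y) i j = ∑ l ∈ Finset.Icc a b, D.coef x i l * D.coef y l j := by
  have hne : ∀ l, D.coef x i l * D.coef y l j ≠ 0 → D.path i l ≠ 0 ∧ D.path l j ≠ 0 :=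
    fun l h => ⟨D.path_ne_of_coef_ne (left_ne_zero_of_mul h),
      D.path_ne_of_coef_ne (right_ne_zero_of_mul h)⟩
  refine D.coef_eq ?_ fun h => Finset.sum_eq_zero fun l _ => ?_
  · rw [D.corner_mul, Finset.sum_smul]
    symm
    rw [Finset.sum_subset (s₂ := Finset.range n)]
    · refine Finset.sum_congr rfl fun l _ => ?_
      rw [D.coef_spec, D.coef_spec, smul_mul_smul_comm]
      by_cases h : D.coef x i l * D.coef y l j = 0
      · rw [h, zero_smul, zero_smul]
      · rw [D.path_mul (hne l h).1 (hne l h).2]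
    · intro l hl
      simp only [Finset.mem_Icc, Finset.mem_range] at *
      omega
    · intro l _ hl
      rw [not_imp_comm.1 (fun h => (D.isPath_path (hne l h).1).mem_Icc
        (D.isPath_path (hne l h).2) hi hj) hl, zero_smul]
  · by_contra hl
    exact D.path_ne (hne l hl).1 (hne l hl).2 h

end LineData

/-! ## The filtration of a vertex space along a line -/

section Filtration

variable {k A : Type} [Field k] [Ring A] [Algebra k A]

/-- The elements fixed by `e`. -/
def fixedSub (k : Type) {A : Type} [Field k] [Ring A] [Algebra k A] (e : A) (X : Type)
    [AddCommGroup X] [Module k X] [Module A X] [IsScalarTower k A X] : Submodule k X :=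
  LinearMap.eqLocus (Algebra.lsmul k k X e) LinearMap.id

/-- The functorial filtration of the space `e i • X` at the end of a line with vertices
`0, …, i`: its steps are `0, …, i + 1`. -/
def lineFil (k : Type) {A : Type} [Field k] [Ring A] [Algebra k A] (e a : ℕ → A) (o : ℕ → Bool)
    (X : Type) [AddCommGroup X] [Module k X] [Module A X] [IsScalarTower k A X] :
    ℕ → ℕ → Submodule k X
  | 0, r => if r = 0 then ⊥ else fixedSub k (e 0) X
  | i + 1, r =>
    if o i then
      if r ≤ i + 1 then (lineFil k e a o X i r).map (Algebra.lsmul k k X (a i))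
      else fixedSub k (e (i + 1)) X
    else
      if r = 0 then ⊥
      else (lineFil k e a o X i (r - 1)).comap (Algebra.lsmul k k X (a i)) ⊓
        fixedSub k (e (i + 1)) X

/-- The initial vertex of the interval which detects the `r`-th step of `lineFil`. -/
def lineStart (o : ℕ → Bool) : ℕ → ℕ → ℕ
  | 0, _ => 0
  | i + 1, r =>
    if o i then if r ≤ i + 1 then lineStart o i r else i + 1
    else if r ≤ 1 then i + 1 else lineStart o i (r - 1)

theorem lineStart_le (o : ℕ → Bool) (i r : ℕ) : lineStart o i r ≤ i := by
  induction i generalizing r with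
  | zero => rfl
  | succ i ih =>
    rw [lineStart]
    split_ifs
    · exact (ih r).trans (Nat.le_succ i)
    · rfl
    · rfl
    · exact (ih _).trans (Nat.le_succ i)

variable {X Y : Type} [AddCommGroup X] [Module k X] [Module A X] [IsScalarTower k A X]
  [AddCommGroup Y] [Module k Y] [Module A Y] [IsScalarTower k A Y]

theorem mem_fixedSub {e : A} {x : X} : x ∈ fixedSub k e X ↔ e • x = x := Iff.rfl

variable {e a : ℕ → A} {o : ℕ → Bool}

theorem lineFil_zero (i : ℕ) : lineFil k e a o X i 0 = ⊥ := by
  induction i with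
  | zero => simp [lineFil]
  | succ i ih => rw [lineFil]; split_ifs <;> simp_all

theorem lineFil_le_fixedSub (ht : ∀ i, e (lineTgt o i) * a i = a i) (i r : ℕ) :
    lineFil k e a o X i r ≤ fixedSub k (e i) X := by
  cases i with
  | zero => rw [lineFil]; split_ifs <;> simp
  | succ i =>
    rw [lineFil]
    split_ifs with ho
    · rintro _ ⟨y, -, rfl⟩
      have := ht i
      rw [lineTgt, if_pos ho] at this
      rw [mem_fixedSub, Algebra.lsmul_coe, smul_smul, this]
    · exact le_rfl
    · exact bot_le
    · exact inf_le_right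

theorem lineFil_top (ht : ∀ i, e (lineTgt o i) * a i = a i) (i : ℕ) :
    lineFil k e a o X i (i + 1) = fixedSub k (e i) X := by
  induction i with
  | zero => simp [lineFil]
  | succ i ih =>
    rw [lineFil]
    split_ifs with ho h h
    · omega
    · rfl
    · simp at h
    · rw [Nat.add_sub_cancel, ih, inf_eq_right]
      intro x _
      have := ht i
      rw [lineTgt, if_neg ho] at this
      rw [Submodule.mem_comap, mem_fixedSub, Algebra.lsmul_coe, smul_smul, this]

theorem lineFil_mono (ht : ∀ i, e (lineTgt o i) * a i = a i) (i r : ℕ) :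
    lineFil k e a o X i r ≤ lineFil k e a o X i (r + 1) := by
  induction i generalizing r with
  | zero => simp only [lineFil]; split_ifs <;> simp_all
  | succ i ih =>
    by_cases ho : o i
    · by_cases hr : r + 1 ≤ i + 1
      · simp only [lineFil, ho, if_true, hr, (Nat.le_succ r).trans hr]
        exact Submodule.map_mono (ih r)
      · refine (lineFil_le_fixedSub ht (i + 1) r).trans (le_of_eq ?_)
        simp [lineFil, ho, hr]
    · cases r with
      | zero => rw [lineFil_zero]; exact bot_le
      | succ r =>
        simp only [lineFil, ho, if_false, Nat.add_sub_cancel, Nat.succ_ne_zero,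
          Bool.false_eq_true]
        exact inf_le_inf (Submodule.comap_mono (ih r)) le_rfl

theorem map_mem_lineFil (f : X →ₗ[A] Y) {i r : ℕ} {x : X} (hx : x ∈ lineFil k e a o X i r) :
    f x ∈ lineFil k e a o Y i r := by
  have hfix : ∀ {c : A} {x : X}, x ∈ fixedSub k c X → f x ∈ fixedSub k c Y :=
    fun h => by rw [mem_fixedSub] at *; rw [← map_smul, h]
  induction i generalizing r x with
  | zero =>
    simp only [lineFil] at *
    split_ifs at * with h
    · simp_all
    · exact hfix hx
  | succ i ih =>
    simp only [lineFil] at *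
    split_ifs at * with ho h h
    · obtain ⟨y, hy, rfl⟩ := hx
      exact ⟨f y, ih hy, by simp⟩
    · exact hfix hx
    · simp_all
    · refine ⟨?_, hfix hx.2⟩
      have := ih hx.1
      simpa using this

/-- An element in the `r`-th step of the filtration is the image of the generator of an
interval module. -/
theorem exists_family_of_mem_lineFil (ht : ∀ i, e (lineTgt o i) * a i = a i) {i r : ℕ}
    (hr : 1 ≤ r) (hri : r ≤ i + 1) {x : X} (hx : x ∈ lineFil k e a o X i r) :
    ∃ y : ℕ → X, y i = x ∧ (∀ j ≤ i, e j • y j = y j) ∧ (∀ j < lineStart o i r, y j = 0) ∧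
      ∀ j < i, lineStart o i r ≤ lineSrc o j → a j • y (lineSrc o j) = y (lineTgt o j) := by
  induction i generalizing r x with
  | zero =>
    have := lineFil_le_fixedSub ht _ _ hx
    refine ⟨fun _ => x, rfl, fun j hj => ?_, fun j hj => ?_, fun j hj => ?_⟩
    · obtain rfl : j = 0 := by omega
      exact this
    · simp [lineStart] at hj
    · omega
  | succ i ih =>
    have hfix : e (i + 1) • x = x := lineFil_le_fixedSub ht _ _ hx
    have extend : ∀ (z : ℕ → X) (c : ℕ), c ≤ i → (∀ j ≤ i, e j • z j = z j) →
        (∀ j < c, z j = 0) →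
        (∀ j < i, c ≤ lineSrc o j → a j • z (lineSrc o j) = z (lineTgt o j)) →
        (o i = true → a i • z i = x) → (o i = false → a i • x = z i) →
        ∃ y : ℕ → X, y (i + 1) = x ∧ (∀ j ≤ i + 1, e j • y j = y j) ∧ (∀ j < c, y j = 0) ∧
          ∀ j < i + 1, c ≤ lineSrc o j → a j • y (lineSrc o j) = y (lineTgt o j) := by
      intro z c hc h1 h2 h3 h4 h5
      refine ⟨fun j => if j = i + 1 then x else z j, by simp, fun j hj => ?_, fun j hj => ?_,
        fun j hj hcj => ?_⟩
      · by_cases hji : j = i + 1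
        · simp [hji, hfix]
        · simp [hji, h1 j (by omega)]
      · have : j ≠ i + 1 := by omega
        simp [this, h2 j hj]
      · by_cases hji : j = i
        · subst hji
          cases ho : o j
          · simp [lineSrc, lineTgt, ho, h5 ho]
          · simp [lineSrc, lineTgt, ho, h4 ho]
        · have hs : lineSrc o j ≠ i + 1 := by rw [lineSrc]; split_ifs <;> omega
          have ht' : lineTgt o j ≠ i + 1 := by rw [lineTgt]; split_ifs <;> omega
          simp [hs, ht', h3 j (by omega) hcj]
    have single : (o i = false → a i • x = 0) →
        ∃ y : ℕ → X, y (i + 1) = x ∧ (∀ j ≤ i + 1, e j • y j = y j) ∧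
          (∀ j < i + 1, y j = 0) ∧
          ∀ j < i + 1, i + 1 ≤ lineSrc o j → a j • y (lineSrc o j) = y (lineTgt o j) := by
      intro h
      refine ⟨fun j => if j = i + 1 then x else 0, by simp, fun j hj => ?_, fun j hj => ?_,
        fun j hj hcj => ?_⟩
      · by_cases hji : j = i + 1
        · simp [hji, hfix]
        · simp [hji]
      · simp [hj.ne]
      · rw [lineSrc] at hcj
        split_ifs at hcj with ho
        · omega
        · obtain rfl : j = i := by omega
          simp [lineSrc, lineTgt, ho, h (by simpa using ho)]
    simp only [lineFil, lineStart] at *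
    by_cases ho : o i
    · simp only [ho, if_true] at hx ⊢
      by_cases h : r ≤ i + 1
      · rw [if_pos h] at hx ⊢
        obtain ⟨w, hw, rfl⟩ := hx
        obtain ⟨z, h0, h1, h2, h3⟩ := ih hr h hw
        exact extend z _ (lineStart_le o i r) h1 h2 h3 (fun _ => by rw [h0]; rfl)
          (fun h => by simp [ho] at h)
      · rw [if_neg h]
        exact single (fun h => by simp [ho] at h)
    · have hr0 : r ≠ 0 := by omega
      simp only [ho, if_false, Bool.false_eq_true, hr0] at hx ⊢
      by_cases h : r ≤ 1
      · rw [if_pos h]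
        refine single fun _ => ?_
        obtain rfl : r = 1 := by omega
        simpa [lineFil_zero] using hx.1
      · rw [if_neg h]
        obtain ⟨z, h0, h1, h2, h3⟩ := ih (r := r - 1) (by omega) (by omega) hx.1
        exact extend z _ (lineStart_le o i _) h1 h2 h3 (fun h => absurd h ho)
          (fun _ => by rw [h0]; rfl)

/-- A functional vanishing on a step of the filtration is a coordinate of a morphism to an
interval module. -/
theorem exists_dual_family (he : ∀ i, e i * e i = e i) (ht : ∀ i, e (lineTgt o i) * a i = a i)
    (hs : ∀ i, a i * e (lineSrc o i) = a i) {i r : ℕ} (hri : r ≤ i) {φ : X →ₗ[k] k}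
    (hφe : ∀ x, φ (e i • x) = φ x) (hφ : ∀ x ∈ lineFil k e a o X i r, φ x = 0) :
    ∃ ψ : ℕ → X →ₗ[k] k, ψ i = φ ∧ (∀ j ≤ i, ∀ x, ψ j (e j • x) = ψ j x) ∧
      (∀ j < lineStart o i (r + 1), ψ j = 0) ∧
      ∀ j < i, lineStart o i (r + 1) ≤ lineTgt o j →
        ∀ x, ψ (lineTgt o j) (a j • x) = ψ (lineSrc o j) x := by
  induction i generalizing r φ with
  | zero =>
    refine ⟨fun _ => φ, rfl, fun j hj => ?_, fun j hj => ?_, fun j hj => ?_⟩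
    · obtain rfl : j = 0 := by omega
      exact hφe
    · simp [lineStart] at hj
    · omega
  | succ i ih =>
    have extend : ∀ (z : ℕ → X →ₗ[k] k) (c : ℕ), c ≤ i →
        (∀ j ≤ i, ∀ x, z j (e j • x) = z j x) → (∀ j < c, z j = 0) →
        (∀ j < i, c ≤ lineTgt o j → ∀ x, z (lineTgt o j) (a j • x) = z (lineSrc o j) x) →
        (o i = true → ∀ x, φ (a i • x) = z i x) → (o i = false → ∀ x, z i (a i • x) = φ x) →
        ∃ ψ : ℕ → X →ₗ[k] k, ψ (i + 1) = φ ∧ (∀ j ≤ i + 1, ∀ x, ψ j (e j • x) = ψ j x) ∧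
          (∀ j < c, ψ j = 0) ∧
          ∀ j < i + 1, c ≤ lineTgt o j →
            ∀ x, ψ (lineTgt o j) (a j • x) = ψ (lineSrc o j) x := by
      intro z c hc h1 h2 h3 h4 h5
      refine ⟨fun j => if j = i + 1 then φ else z j, by simp, fun j hj x => ?_, fun j hj => ?_,
        fun j hj hcj x => ?_⟩
      · by_cases hji : j = i + 1
        · subst hji; simp [hφe]
        · simp [hji, h1 j (by omega)]
      · have : j ≠ i + 1 := by omega
        simp [this, h2 j hj]
      · by_cases hji : j = i
        · subst hji
          cases ho : o j
          · simp [lineSrc, lineTgt, ho, h5 ho]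
          · simp [lineSrc, lineTgt, ho, h4 ho]
        · have hs : lineSrc o j ≠ i + 1 := by rw [lineSrc]; split_ifs <;> omega
          have ht' : lineTgt o j ≠ i + 1 := by rw [lineTgt]; split_ifs <;> omega
          simp [hs, ht', h3 j (by omega) hcj]
    have single : (o i = true → ∀ x, φ (a i • x) = 0) →
        ∃ ψ : ℕ → X →ₗ[k] k, ψ (i + 1) = φ ∧ (∀ j ≤ i + 1, ∀ x, ψ j (e j • x) = ψ j x) ∧
          (∀ j < i + 1, ψ j = 0) ∧
          ∀ j < i + 1, i + 1 ≤ lineTgt o j →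
            ∀ x, ψ (lineTgt o j) (a j • x) = ψ (lineSrc o j) x := by
      intro h
      refine ⟨fun j => if j = i + 1 then φ else 0, by simp, fun j hj x => ?_, fun j hj => ?_,
        fun j hj hcj x => ?_⟩
      · by_cases hji : j = i + 1
        · subst hji; simp [hφe]
        · simp [hji]
      · simp [hj.ne]
      · rw [lineTgt] at hcj
        split_ifs at hcj with ho
        · obtain rfl : j = i := by omega
          simp [lineSrc, lineTgt, ho, h ho]
        · omega
    simp only [lineFil, lineStart, Nat.add_sub_cancel, Nat.add_le_add_iff_right] at *
    have hti := ht i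
    have hsi := hs i
    rw [lineTgt] at hti
    rw [lineSrc] at hsi
    by_cases ho : o i
    · simp only [ho, if_true] at hφ hti hsi ⊢
      by_cases h : r ≤ i
      · rw [if_pos (by omega)] at hφ
        rw [if_pos h]
        obtain ⟨z, h0, h1, h2, h3⟩ := ih h (φ := φ.comp (Algebra.lsmul k k X (a i)))
          (fun x => by simp [smul_smul, hsi])
          (fun x hx => hφ _ ⟨x, hx, rfl⟩)
        exact extend z _ (lineStart_le o i _) h1 h2 h3 (fun _ x => by rw [h0]; rfl)
          (fun h => by simp [ho] at h)
      · rw [if_neg h]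
        obtain rfl : r = i + 1 := by omega
        rw [if_pos le_rfl, lineFil_top ht] at hφ
        refine single fun _ x => hφ _ ⟨e i • x, ?_, ?_⟩
        · rw [SetLike.mem_coe, mem_fixedSub, smul_smul, he]
        · change a i • e i • x = a i • x
          rw [smul_smul, hsi]
    · simp only [ho, if_false, Bool.false_eq_true] at hφ hti hsi ⊢
      by_cases h : r = 0
      · rw [if_pos (by omega)]
        exact single fun h => absurd h ho
      · obtain ⟨s, rfl⟩ : ∃ s, r = s + 1 := ⟨r - 1, by omega⟩
        rw [if_neg h, Nat.add_sub_cancel] at hφ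
        rw [if_neg (by omega)]
        set F := lineFil k e a o X i s with hF
        obtain ⟨χ, hχ⟩ : ∃ χ : Module.Dual k (X ⧸ F),
            χ.comp (F.mkQ.comp (Algebra.lsmul k k X (a i))) = φ := by
          have : φ ∈ LinearMap.range (F.mkQ.comp (Algebra.lsmul k k X (a i))).dualMap := by
            rw [LinearMap.range_dualMap_eq_dualAnnihilator_ker, Submodule.mem_dualAnnihilator]
            intro x hx
            rw [← hφe]
            refine hφ _ ⟨?_, ?_⟩
            · change a i • e (i + 1) • x ∈ F
              rw [smul_smul, hsi]
              simpa using hx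
            · rw [SetLike.mem_coe, mem_fixedSub, smul_smul, he]
          exact this
        obtain ⟨z, h0, h1, h2, h3⟩ := ih (r := s) (by omega)
          (φ := (χ.comp F.mkQ).comp (Algebra.lsmul k k X (e i)))
          (fun x => by simp [smul_smul, he])
          (fun x hx => by
            have hx' : e i • x = x := lineFil_le_fixedSub ht _ _ hx
            simp only [LinearMap.comp_apply, Algebra.lsmul_coe, hx']
            rw [Submodule.mkQ_apply, (Submodule.Quotient.mk_eq_zero F).2 hx, map_zero])
        refine extend z _ (lineStart_le o i _) h1 h2 h3 (fun h => absurd h ho) (fun _ x => ?_)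
        rw [h0, ← hχ]
        simp [smul_smul, hti]

end Filtration

/-! ## Interval modules -/

namespace LineData

variable {k A : Type} [Field k] [Ring A] [Algebra k A] {n : ℕ} (D : LineData k A n)

/-- The module with one-dimensional spaces at the vertices `p, …, q` and identities along the
arrows between them. -/
def Interval (_D : LineData k A n) (p q : ℕ) (_hq : q < n) : Type := ↥(Finset.Icc p q) → k

namespace Interval

variable {D} {p q : ℕ} {hq : q < n}

instance : AddCommGroup (D.Interval p q hq) :=
  inferInstanceAs (AddCommGroup (↥(Finset.Icc p q) → k))

instance : Module k (D.Interval p q hq) := inferInstanceAs (Module k (↥(Finset.Icc p q) → k))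

instance : Module.Finite k (D.Interval p q hq) :=
  inferInstanceAs (Module.Finite k (↥(Finset.Icc p q) → k))

/-- The coordinate at a vertex, which is `0` outside the interval. -/
def coord (i : ℕ) : D.Interval p q hq →ₗ[k] k where
  toFun m := if h : i ∈ Finset.Icc p q then m ⟨i, h⟩ else 0
  map_add' m m' := by
    split_ifs
    · rfl
    · simp
  map_smul' c m := by
    split_ifs
    · rfl
    · simp

theorem coord_apply {i : ℕ} (h : i ∈ Finset.Icc p q) (m : D.Interval p q hq) :
    coord i m = m ⟨i, h⟩ := dif_pos h

/-- The element with given coordinates. -/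
def mk (f : ℕ → k) : D.Interval p q hq := fun i => f i

theorem coord_of_notMem {i : ℕ} (h : i ∉ Finset.Icc p q) (m : D.Interval p q hq) :
    coord i m = 0 := dif_neg h

theorem coord_mk {i : ℕ} (h : i ∈ Finset.Icc p q) (f : ℕ → k) :
    coord i (mk f : D.Interval p q hq) = f i := dif_pos h

theorem ext_coord {m m' : D.Interval p q hq}
    (h : ∀ i ∈ Finset.Icc p q, coord i m = coord i m') : m = m' := by
  funext i
  have := h i.1 i.2
  rwa [coord_apply i.2, coord_apply i.2] at this

noncomputable instance : SMul A (D.Interval p q hq) :=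
  ⟨fun x m => mk fun i => ∑ j ∈ Finset.Icc p q, D.coef x i j * coord j m⟩

theorem coord_smul {i : ℕ} (hi : i ∈ Finset.Icc p q) (x : A) (m : D.Interval p q hq) :
    coord i (x • m) = ∑ j ∈ Finset.Icc p q, D.coef x i j * coord j m := coord_mk hi _

theorem lt_of_mem {i : ℕ} (hq : q < n) (hi : i ∈ Finset.Icc p q) : i < n :=
  (Finset.mem_Icc.1 hi).2.trans_lt hq

theorem algebraMap_smul_eq (r : k) (m : D.Interval p q hq) : algebraMap k A r • m = r • m := by
  refine ext_coord fun i hi => ?_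
  rw [coord_smul hi, map_smul, smul_eq_mul]
  simp only [D.coef_algebraMap r (lt_of_mem hq hi), ite_mul, zero_mul]
  rw [Finset.sum_ite_eq, if_pos hi]

noncomputable instance : Module A (D.Interval p q hq) where
  one_smul m := by
    have := algebraMap_smul_eq (1 : k) m
    rwa [map_one, one_smul] at this
  mul_smul x y m := by
    refine ext_coord fun i hi => ?_
    rw [coord_smul hi, coord_smul hi]
    calc _ = ∑ j ∈ Finset.Icc p q, ∑ l ∈ Finset.Icc p q,
          D.coef x i l * D.coef y l j * coord j m :=
        Finset.sum_congr rfl fun j hj => by rw [D.coef_mul x y hq hi hj, Finset.sum_mul]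
      _ = _ := by
        rw [Finset.sum_comm]
        refine Finset.sum_congr rfl fun l hl => ?_
        rw [coord_smul hl, Finset.mul_sum]
        exact Finset.sum_congr rfl fun j _ => mul_assoc _ _ _
  smul_zero x := ext_coord fun i hi => by simp [coord_smul hi]
  smul_add x m m' := ext_coord fun i hi => by
    simp [coord_smul hi, mul_add, Finset.sum_add_distrib]
  add_smul x y m := ext_coord fun i hi => by
    simp [coord_smul hi, D.coef_add, add_mul, Finset.sum_add_distrib]
  zero_smul m := by
    have := algebraMap_smul_eq (0 : k) m
    rwa [map_zero, zero_smul] at this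

instance : IsScalarTower k A (D.Interval p q hq) :=
  ⟨fun r x m => by rw [Algebra.smul_def, mul_smul, algebraMap_smul_eq]⟩

theorem coord_e_smul {i : ℕ} (l : ℕ) (m : D.Interval p q hq) :
    coord i (D.e l • m) = if i = l then coord i m else 0 := by
  by_cases hi : i ∈ Finset.Icc p q
  · rw [coord_smul hi]
    simp only [D.coef_e (lt_of_mem hq hi), ite_mul, zero_mul, one_mul]
    split_ifs with h
    · subst h
      simp only [true_and]
      rw [Finset.sum_ite_eq', if_pos hi]
    · simp [h]
  · simp [coord_of_notMem hi]

theorem coord_a_smul {i : ℕ} (hi : i ∈ Finset.Icc p q) {l : ℕ} (hl : l + 1 < n)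
    (m : D.Interval p q hq) :
    coord i (D.a l • m) = if i = lineTgt D.o l then coord (lineSrc D.o l) m else 0 := by
  rw [coord_smul hi]
  simp only [D.coef_a hl, ite_mul, zero_mul, one_mul]
  split_ifs with h
  · simp only [h, true_and]
    rw [Finset.sum_ite_eq']
    split_ifs with h'
    · rfl
    · rw [coord_of_notMem h']
  · simp [h]

end Interval

theorem exists_linearMap_of_comm {X Y : Type} [AddCommGroup X] [Module k X] [Module A X]
    [IsScalarTower k A X] [AddCommGroup Y] [Module k Y] [Module A Y] [IsScalarTower k A Y]
    (f : X →ₗ[k] Y) (he : ∀ i x, f (D.e i • x) = D.e i • f x)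
    (ha : ∀ i, i + 1 < n → ∀ x, f (D.a i • x) = D.a i • f x) :
    ∃ g : X →ₗ[A] Y, ∀ x, g x = f x := by
  refine ⟨⟨f.toAddHom, fun r x => ?_⟩, fun x => rfl⟩
  change f (r • x) = r • f x
  have hr : r ∈ Algebra.adjoin k (Set.range D.e ∪ Set.range D.a) := by rw [D.gen]; trivial
  induction hr using Algebra.adjoin_induction generalizing x with
  | mem r hr =>
    rcases hr with ⟨i, rfl⟩ | ⟨i, rfl⟩
    · exact he i x
    · by_cases hi : i + 1 < n
      · exact ha i hi x
      · simp [D.a_zero i (not_lt.1 hi)]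
  | algebraMap r => simp
  | add r s _ _ hr hs => rw [add_smul, map_add, hr, hs, add_smul]
  | mul r s _ _ hr hs => rw [mul_smul, hr, hs, mul_smul]

section Hom

variable {p q : ℕ} (hq : q < n) {X : Type} [AddCommGroup X] [Module k X] [Module A X]
  [IsScalarTower k A X]

theorem exists_hom_to_interval {ψ : ℕ → X →ₗ[k] k}
    (h1 : ∀ j ∈ Finset.Icc p q, ∀ x, ψ j (D.e j • x) = ψ j x)
    (h2 : ∀ j ∉ Finset.Icc p q, ψ j = 0)
    (h3 : ∀ l, l + 1 < n → lineTgt D.o l ∈ Finset.Icc p q →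
      ∀ x, ψ (lineTgt D.o l) (D.a l • x) = ψ (lineSrc D.o l) x) :
    ∃ g : X →ₗ[A] D.Interval p q hq, ∀ x j, Interval.coord j (g x) = ψ j x := by
  set f : X →ₗ[k] D.Interval p q hq :=
    LinearMap.pi (φ := fun _ : ↥(Finset.Icc p q) => k) fun j => ψ j with hf
  have hfc : ∀ x j, Interval.coord j (f x) = ψ j x := by
    intro x j
    by_cases hj : j ∈ Finset.Icc p q
    · rw [Interval.coord_apply hj]; rfl
    · rw [Interval.coord_of_notMem hj, h2 j hj, LinearMap.zero_apply]
  have he : ∀ i x, f (D.e i • x) = D.e i • f x := by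
    intro i x
    refine Interval.ext_coord fun j hj => ?_
    rw [Interval.coord_e_smul, hfc, hfc]
    split_ifs with h
    · rw [← h, h1 j hj]
    · rw [← h1 j hj, smul_smul, D.e_mul_ne _ _ h, zero_smul, map_zero]
  have ha : ∀ l, l + 1 < n → ∀ x, f (D.a l • x) = D.a l • f x := by
    intro l hl x
    refine Interval.ext_coord fun j hj => ?_
    rw [Interval.coord_a_smul hj hl, hfc, hfc]
    split_ifs with h
    · subst h
      exact h3 l hl hj x
    · rw [← h1 j hj, ← D.tgt_mul l, ← mul_smul, ← mul_assoc, D.e_mul_ne _ _ h, zero_mul,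
        zero_smul, map_zero]
  obtain ⟨g, hg⟩ := D.exists_linearMap_of_comm f he ha
  exact ⟨g, fun x j => by rw [hg, hfc]⟩

theorem exists_hom_from_interval {y : ℕ → X}
    (h1 : ∀ j ∈ Finset.Icc p q, D.e j • y j = y j) (h2 : ∀ j ∉ Finset.Icc p q, y j = 0)
    (h3 : ∀ l, l + 1 < n → lineSrc D.o l ∈ Finset.Icc p q →
      D.a l • y (lineSrc D.o l) = y (lineTgt D.o l)) :
    ∃ g : D.Interval p q hq →ₗ[A] X,
      ∀ m, g m = ∑ j ∈ Finset.Icc p q, Interval.coord j m • y j := by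
  have : SMulCommClass k A X := IsScalarTower.to_smulCommClass
  set f : D.Interval p q hq →ₗ[k] X :=
    ∑ j ∈ Finset.Icc p q, (Interval.coord j).smulRight (y j) with hf
  have hfc : ∀ m, f m = ∑ j ∈ Finset.Icc p q, Interval.coord j m • y j := fun m => by simp [hf]
  have he : ∀ i x, f (D.e i • x) = D.e i • f x := by
    intro i x
    rw [hfc, hfc, Finset.smul_sum]
    refine Finset.sum_congr rfl fun j hj => ?_
    rw [Interval.coord_e_smul, smul_comm]
    split_ifs with h
    · rw [← h, h1 j hj]
    · rw [← h1 j hj, smul_smul (D.e i), D.e_mul_ne _ _ (Ne.symm h), zero_smul, zero_smul,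
        smul_zero]
  have ha : ∀ l, l + 1 < n → ∀ x, f (D.a l • x) = D.a l • f x := by
    intro l hl x
    rw [hfc, hfc, Finset.smul_sum]
    trans (Interval.coord (lineSrc D.o l) x) • y (lineTgt D.o l)
    · rw [Finset.sum_congr rfl fun j hj => by rw [Interval.coord_a_smul hj hl]]
      simp only [ite_smul, zero_smul]
      rw [Finset.sum_ite_eq']
      split_ifs with h
      · rfl
      · rw [h2 _ h, smul_zero]
    · symm
      rw [Finset.sum_eq_single (lineSrc D.o l)]
      · by_cases h : lineSrc D.o l ∈ Finset.Icc p q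
        · rw [smul_comm, h3 l hl h]
        · rw [Interval.coord_of_notMem h, zero_smul, zero_smul, smul_zero]
      · intro j hj hjl
        rw [← h1 j hj, ← D.mul_src l, smul_comm, smul_smul, mul_assoc, D.e_mul_ne _ _ hjl.symm,
          mul_zero, zero_smul, smul_zero]
      · intro h
        rw [Interval.coord_of_notMem h, zero_smul, smul_zero]
  obtain ⟨g, hg⟩ := D.exists_linearMap_of_comm f he ha
  exact ⟨g, fun m => by rw [hg, hfc]⟩

end Hom

namespace Interval

variable {D} {p q : ℕ} {hq : q < n}

/-- The basis element at a vertex. -/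
def single (D : LineData k A n) (hq : q < n) (j : ℕ) : D.Interval p q hq :=
  mk fun i => if i = j then 1 else 0

theorem coord_single {i j : ℕ} (hi : i ∈ Finset.Icc p q) :
    coord i (single D hq j : D.Interval p q hq) = if i = j then 1 else 0 := coord_mk hi _

theorem e_smul (j : ℕ) (m : D.Interval p q hq) : D.e j • m = coord j m • single D hq j := by
  refine ext_coord fun i hi => ?_
  rw [coord_e_smul, map_smul, coord_single hi]
  split_ifs with h <;> simp [h]

theorem a_smul_single {l : ℕ} (hl : l + 1 < n) (h : lineSrc D.o l ∈ Finset.Icc p q) :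
    D.a l • (single D hq (lineSrc D.o l) : D.Interval p q hq) =
      single D hq (lineTgt D.o l) := by
  refine ext_coord fun i hi => ?_
  rw [coord_a_smul hi hl, coord_single h, coord_single hi, if_pos rfl]

/-- Endomorphisms of interval modules are scalars. -/
theorem exists_eq_smul (f : D.Interval p q hq →ₗ[A] D.Interval p q hq) :
    ∃ c : k, ∀ m, f m = c • m := by
  set c : ℕ → k := fun j => coord j (f (single D hq j)) with hc
  have hstep : ∀ l, p ≤ l → l + 1 ≤ q → c (l + 1) = c l := by
    intro l hl hlq
    have hln : l + 1 < n := by omega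
    have hs : lineSrc D.o l ∈ Finset.Icc p q := by
      rw [Finset.mem_Icc, lineSrc]; split_ifs <;> omega
    have ht : lineTgt D.o l ∈ Finset.Icc p q := by
      rw [Finset.mem_Icc, lineTgt]; split_ifs <;> omega
    have key : c (lineTgt D.o l) = c (lineSrc D.o l) := by
      simp only [hc]
      rw [← a_smul_single hln hs, map_smul, coord_a_smul ht hln, if_pos rfl]
    rw [lineSrc, lineTgt] at key
    split_ifs at key
    · exact key
    · exact key.symm
  have hconst : ∀ d, p + d ≤ q → c (p + d) = c p := by
    intro d
    induction d with
    | zero => exact fun _ => rfl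
    | succ d ih => exact fun h => (hstep (p + d) (by omega) h).trans (ih (by omega))
  refine ⟨c p, fun m => ext_coord fun i hi => ?_⟩
  have hci : c i = c p := by
    rw [Finset.mem_Icc] at hi
    have := hconst (i - p) (by omega)
    rwa [Nat.add_sub_cancel' hi.1] at this
  have h1 : coord i (f m) = coord i (D.e i • f m) := by rw [coord_e_smul, if_pos rfl]
  rw [h1, ← map_smul, e_smul, LinearMap.map_smul_of_tower, map_smul, map_smul, ← hci,
    smul_eq_mul, smul_eq_mul, mul_comm]

theorem single_ne_zero {j : ℕ} (hj : j ∈ Finset.Icc p q) :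
    (single D hq j : D.Interval p q hq) ≠ 0 := fun h => by
  have := coord_single (D := D) (hq := hq) (j := j) hj
  rw [h, map_zero, if_pos rfl] at this
  exact zero_ne_one this

theorem finIndec (hpq : p ≤ q) : FinIndec A (ModuleCat.of A (D.Interval p q hq)) := by
  refine ⟨Module.Finite.of_restrictScalars_finite k A (D.Interval p q hq),
    ⟨⟨single D hq p, 0, single_ne_zero (Finset.left_mem_Icc.2 hpq)⟩⟩, fun f hf => ?_⟩
  obtain ⟨c, hc⟩ := exists_eq_smul f.hom
  have h1 := LinearMap.congr_fun (congrArg ModuleCat.Hom.hom hf) (single D hq p)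
  have h2 : c • c • (single D hq p : D.Interval p q hq) = c • single D hq p := by
    rw [← hc, ← hc]; exact h1
  rw [smul_smul, ← sub_eq_zero, ← sub_smul, smul_eq_zero] at h2
  have h3 := h2.resolve_right (single_ne_zero (Finset.left_mem_Icc.2 hpq))
  have h4 : c * (c - 1) = 0 := by rw [mul_sub, mul_one, h3]
  rcases mul_eq_zero.1 h4 with h | h
  · left
    ext m
    exact (hc m).trans (by rw [h, zero_smul]; rfl)
  · right
    ext m
    exact (hc m).trans (by rw [sub_eq_zero.1 h, one_smul]; rfl)

theorem isIso_of_coord_ne_zero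
    (f : ModuleCat.of A (D.Interval p q hq) ⟶ ModuleCat.of A (D.Interval p q hq))
    {m : D.Interval p q hq} {j : ℕ} (h : (coord j : D.Interval p q hq →ₗ[k] k) (f.hom m) ≠ 0) : IsIso f := by
  obtain ⟨c, hc⟩ := exists_eq_smul f.hom
  have hc0 : c ≠ 0 := by
    rintro rfl
    rw [hc, zero_smul, map_zero] at h
    exact h rfl
  rw [ConcreteCategory.isIso_iff_bijective]
  refine ⟨fun x y hxy => ?_, fun y => ⟨c⁻¹ • (show D.Interval p q hq from y), ?_⟩⟩
  · have hxy' : c • (show D.Interval p q hq from x) = c • (show D.Interval p q hq from y) := by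
      rw [← hc, ← hc]; exact hxy
    exact smul_right_injective _ hc0 hxy'
  · exact (hc _).trans (smul_inv_smul₀ hc0 _)

end Interval

end LineData

/-! ## Radical morphisms and the two filtrations of a vertex space -/

namespace LineData

variable {k A : Type} [Field k] [Ring A] [Algebra k A] {n : ℕ} (D : LineData k A n)

/-- The vertices read from right to left. -/
def revE (i : ℕ) : A := D.e (n - 1 - i)

/-- The arrows read from right to left. -/
def revA (i : ℕ) : A := if i + 2 ≤ n then D.a (n - 2 - i) else 0

/-- The orientation read from right to left. -/
def revO (i : ℕ) : Bool := !D.o (n - 2 - i)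

theorem revE_mul_self (i : ℕ) : D.revE i * D.revE i = D.revE i := D.e_mul_self _

theorem lineTgt_rev {l : ℕ} (hl : l + 1 < n) :
    lineTgt D.revO (n - 2 - l) = n - 1 - lineTgt D.o l := by
  rw [lineTgt, lineTgt, revO, show n - 2 - (n - 2 - l) = l by omega]
  cases D.o l <;> simp <;> omega

theorem lineSrc_rev {l : ℕ} (hl : l + 1 < n) :
    lineSrc D.revO (n - 2 - l) = n - 1 - lineSrc D.o l := by
  rw [lineSrc, lineSrc, revO, show n - 2 - (n - 2 - l) = l by omega]
  cases D.o l <;> simp <;> omega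

theorem lineTgt_lt {l : ℕ} (hl : l + 1 < n) : lineTgt D.o l < n := by
  rw [lineTgt]; split_ifs <;> omega

theorem lineSrc_lt {l : ℕ} (hl : l + 1 < n) : lineSrc D.o l < n := by
  rw [lineSrc]; split_ifs <;> omega

theorem revE_rev {j : ℕ} (hj : j < n) : D.revE (n - 1 - j) = D.e j := by
  rw [revE, show n - 1 - (n - 1 - j) = j by omega]

theorem revA_rev {l : ℕ} (hl : l + 1 < n) : D.revA (n - 2 - l) = D.a l := by
  rw [revA, if_pos (by omega), show n - 2 - (n - 2 - l) = l by omega]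

theorem rev_tgt_mul (i : ℕ) : D.revE (lineTgt D.revO i) * D.revA i = D.revA i := by
  by_cases hi : i + 2 ≤ n
  · obtain ⟨l, hl, rfl⟩ : ∃ l, l + 1 < n ∧ i = n - 2 - l := ⟨n - 2 - i, by omega, by omega⟩
    rw [D.lineTgt_rev hl, D.revE_rev (D.lineTgt_lt hl), D.revA_rev hl, D.tgt_mul]
  · rw [revA, if_neg hi, mul_zero]

theorem rev_mul_src (i : ℕ) : D.revA i * D.revE (lineSrc D.revO i) = D.revA i := by
  by_cases hi : i + 2 ≤ n
  · obtain ⟨l, hl, rfl⟩ : ∃ l, l + 1 < n ∧ i = n - 2 - l := ⟨n - 2 - i, by omega, by omega⟩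
    rw [D.lineSrc_rev hl, D.revE_rev (D.lineSrc_lt hl), D.revA_rev hl, D.mul_src]
  · rw [revA, if_neg hi, zero_mul]

section TwoFiltrations

variable (X Y : Type) [AddCommGroup X] [Module k X] [Module A X] [IsScalarTower k A X]
  [AddCommGroup Y] [Module k Y] [Module A Y] [IsScalarTower k A Y]

/-- The filtration of the space at the vertex `v` coming from the vertices `≤ v`. -/
def leftFil (v r : ℕ) : Submodule k X := lineFil k D.e D.a D.o X v r

/-- The filtration of the space at the vertex `v` coming from the vertices `≥ v`. -/
def rightFil (v s : ℕ) : Submodule k X := lineFil k D.revE D.revA D.revO X (n - 1 - v) s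

variable {X Y}

theorem leftFil_le (v r : ℕ) : D.leftFil X v r ≤ fixedSub k (D.e v) X :=
  lineFil_le_fixedSub D.tgt_mul v r

theorem rightFil_le {v : ℕ} (hv : v < n) (s : ℕ) :
    D.rightFil X v s ≤ fixedSub k (D.e v) X := by
  have := lineFil_le_fixedSub (k := k) (X := X) D.rev_tgt_mul (n - 1 - v) s
  rwa [D.revE_rev hv] at this

/-- Families indexed by the vertices `≤ v` and, from right to left, by the vertices `≥ v`,
combined. -/
def glue {Z : Type} [Zero Z] (n v : ℕ) (yl yr : ℕ → Z) (j : ℕ) : Z :=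
  if j ≤ v then yl j else if j < n then yr (n - 1 - j) else 0

theorem glue_left {Z : Type} [Zero Z] {v j : ℕ} (yl yr : ℕ → Z) (hj : j ≤ v) :
    glue n v yl yr j = yl j := if_pos hj

theorem glue_right {Z : Type} [Zero Z] {v j : ℕ} {yl yr : ℕ → Z} (h : yl v = yr (n - 1 - v))
    (hj : v ≤ j) (hjn : j < n) : glue n v yl yr j = yr (n - 1 - j) := by
  rcases hj.eq_or_lt with rfl | hj
  · rw [glue_left _ _ le_rfl, h]
  · rw [glue, if_neg (by omega), if_pos hjn]

theorem glue_eq_zero {Z : Type} [Zero Z] {v j c d : ℕ} {yl yr : ℕ → Z} (hv : v < n) (hc : c ≤ v)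
    (hd : d ≤ n - 1 - v) (h1 : ∀ j < c, yl j = 0) (h2 : ∀ j < d, yr j = 0)
    (hj : j ∉ Finset.Icc c (n - 1 - d)) : glue n v yl yr j = 0 := by
  rw [Finset.mem_Icc] at hj
  rw [glue]
  split_ifs with h h'
  · exact h1 j (by omega)
  · exact h2 _ (by omega)
  · rfl

theorem exists_hom_from_interval_of_mem {v r s : ℕ} (hv : v < n) (hr : r ≤ v)
    (hs : s ≤ n - 1 - v) {x : X} (hx : x ∈ D.leftFil X v (r + 1))
    (hx' : x ∈ D.rightFil X v (s + 1)) {p q : ℕ} (hp : p = lineStart D.o v (r + 1))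
    (hq' : q = n - 1 - lineStart D.revO (n - 1 - v) (s + 1)) (hq : q < n) :
    ∃ f : D.Interval p q hq →ₗ[A] X, f (Interval.single D hq v) = x := by
  obtain ⟨yl, l0, l1, l2, l3⟩ := exists_family_of_mem_lineFil D.tgt_mul (Nat.le_add_left 1 r)
    (Nat.succ_le_succ hr) hx
  obtain ⟨yr, r0, r1, r2, r3⟩ := exists_family_of_mem_lineFil D.rev_tgt_mul (Nat.le_add_left 1 s)
    (Nat.succ_le_succ hs) hx'
  have hpv := lineStart_le D.o v (r + 1)
  have hqv := lineStart_le D.revO (n - 1 - v) (s + 1)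
  rw [← hp] at l2 l3 hpv
  have hlr : yl v = yr (n - 1 - v) := l0.trans r0.symm
  have h2 : ∀ j ∉ Finset.Icc p q, glue n v yl yr j = 0 :=
    fun j hj => glue_eq_zero hv hpv hqv l2 r2 (hq' ▸ hj)
  have he : ∀ j ∈ Finset.Icc p q, D.e j • glue n v yl yr j = glue n v yl yr j := by
    intro j hj
    rw [Finset.mem_Icc] at hj
    rcases le_total j v with h | h
    · rw [glue_left _ _ h, l1 j h]
    · rw [glue_right hlr h (by omega), ← D.revE_rev (by omega), r1 _ (by omega)]
  have ha : ∀ l, l + 1 < n → lineSrc D.o l ∈ Finset.Icc p q →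
      D.a l • glue n v yl yr (lineSrc D.o l) = glue n v yl yr (lineTgt D.o l) := by
    intro l hl hlm
    rw [Finset.mem_Icc] at hlm
    by_cases hlv : l < v
    · rw [glue_left, glue_left, l3 l hlv hlm.1]
      · rw [lineTgt]; split_ifs <;> omega
      · rw [lineSrc]; split_ifs <;> omega
    · rw [glue_right hlr _ (D.lineSrc_lt hl), glue_right hlr _ (D.lineTgt_lt hl),
        ← D.lineSrc_rev hl, ← D.lineTgt_rev hl, ← D.revA_rev hl, r3 _ (by omega)]
      · rw [D.lineSrc_rev hl]; omega
      · rw [lineTgt]; split_ifs <;> omega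
      · rw [lineSrc]; split_ifs <;> omega
  obtain ⟨f, hf⟩ := D.exists_hom_from_interval hq he h2 ha
  refine ⟨f, ?_⟩
  have hvm : v ∈ Finset.Icc p q := Finset.mem_Icc.2 ⟨hpv, by omega⟩
  rw [hf, Finset.sum_eq_single v (fun j hj hjv => ?_) (fun h => absurd hvm h)]
  · rw [Interval.coord_single hvm, if_pos rfl, one_smul, glue_left _ _ le_rfl, l0]
  · rw [Interval.coord_single hj, if_neg hjv, zero_smul]

theorem exists_hom_to_interval_of_forall {v r s : ℕ} (hv : v < n) (hr : r ≤ v)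
    (hs : s ≤ n - 1 - v) {φ : X →ₗ[k] k} (hφ : ∀ x, φ (D.e v • x) = φ x)
    (hl : ∀ x ∈ D.leftFil X v r, φ x = 0) (hr' : ∀ x ∈ D.rightFil X v s, φ x = 0)
    {p q : ℕ} (hp : p = lineStart D.o v (r + 1))
    (hq' : q = n - 1 - lineStart D.revO (n - 1 - v) (s + 1)) (hq : q < n) :
    ∃ f : X →ₗ[A] D.Interval p q hq, ∀ x, Interval.coord v (f x) = φ x := by
  obtain ⟨yl, l0, l1, l2, l3⟩ := exists_dual_family D.e_mul_self D.tgt_mul D.mul_src hr hφ hl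
  obtain ⟨yr, r0, r1, r2, r3⟩ := exists_dual_family D.revE_mul_self D.rev_tgt_mul D.rev_mul_src
    hs (by rwa [D.revE_rev hv]) hr'
  have hpv := lineStart_le D.o v (r + 1)
  have hqv := lineStart_le D.revO (n - 1 - v) (s + 1)
  rw [← hp] at l2 l3 hpv
  have hlr : yl v = yr (n - 1 - v) := l0.trans r0.symm
  have h2 : ∀ j ∉ Finset.Icc p q, glue n v yl yr j = 0 :=
    fun j hj => glue_eq_zero hv hpv hqv l2 r2 (hq' ▸ hj)
  have he : ∀ j ∈ Finset.Icc p q, ∀ x, glue n v yl yr j (D.e j • x) = glue n v yl yr j x := by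
    intro j hj x
    rw [Finset.mem_Icc] at hj
    rcases le_total j v with h | h
    · rw [glue_left _ _ h, l1 j h]
    · rw [glue_right hlr h (by omega), ← D.revE_rev (by omega), r1 _ (by omega)]
  have ha : ∀ l, l + 1 < n → lineTgt D.o l ∈ Finset.Icc p q →
      ∀ x, glue n v yl yr (lineTgt D.o l) (D.a l • x) = glue n v yl yr (lineSrc D.o l) x := by
    intro l hl hlm x
    rw [Finset.mem_Icc] at hlm
    by_cases hlv : l < v
    · rw [glue_left, glue_left, l3 l hlv hlm.1]
      · rw [lineSrc]; split_ifs <;> omega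
      · rw [lineTgt]; split_ifs <;> omega
    · rw [glue_right hlr _ (D.lineSrc_lt hl), glue_right hlr _ (D.lineTgt_lt hl),
        ← D.lineSrc_rev hl, ← D.lineTgt_rev hl, ← D.revA_rev hl, r3 _ (by omega)]
      · rw [D.lineTgt_rev hl]; omega
      · rw [lineTgt]; split_ifs <;> omega
      · rw [lineSrc]; split_ifs <;> omega
  obtain ⟨f, hf⟩ := D.exists_hom_to_interval hq he h2 ha
  exact ⟨f, fun x => by rw [hf, glue_left _ _ le_rfl, l0]⟩

/-- A linear map which moves the double filtration by too little factors a non-zero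
endomorphism of an interval module. -/
theorem exists_coord_ne_zero (g : X →ₗ[A] Y) {v r s : ℕ} (hv : v < n) (hr : r ≤ v)
    (hs : s ≤ n - 1 - v) {x : X} (hx : x ∈ D.leftFil X v (r + 1))
    (hx' : x ∈ D.rightFil X v (s + 1)) (hgx : g x ∉ D.leftFil Y v r ⊔ D.rightFil Y v s) :
    ∃ (p q : ℕ) (hq : q < n), p ≤ q ∧ ∃ (f : D.Interval p q hq →ₗ[A] X)
      (h : Y →ₗ[A] D.Interval p q hq) (m : D.Interval p q hq), Interval.coord v (h (g (f m))) ≠ 0 := by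
  obtain ⟨φ, hφ, hker⟩ := Submodule.exists_le_ker_of_notMem hgx
  have hex : D.e v • x = x := D.leftFil_le _ _ hx
  have hpv := lineStart_le D.o v (r + 1)
  have hqv := lineStart_le D.revO (n - 1 - v) (s + 1)
  have hq : n - 1 - lineStart D.revO (n - 1 - v) (s + 1) < n := by omega
  obtain ⟨f, hf⟩ := D.exists_hom_from_interval_of_mem hv hr hs hx hx' rfl rfl hq
  obtain ⟨h, hh⟩ := D.exists_hom_to_interval_of_forall (X := Y) hv hr hs
    (φ := φ.comp (Algebra.lsmul k k Y (D.e v)))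
    (fun y => by simp [smul_smul, D.e_mul_self])
    (fun y hy => by
      have h1 : D.e v • y = y := D.leftFil_le _ _ hy
      have h2 := hker (Submodule.mem_sup_left hy)
      simpa [h1] using h2)
    (fun y hy => by
      have h1 : D.e v • y = y := D.rightFil_le hv _ hy
      have h2 := hker (Submodule.mem_sup_right hy)
      simpa [h1] using h2) rfl rfl hq
  refine ⟨_, _, hq, by omega, f, h, Interval.single D hq v, ?_⟩
  rw [hf, hh]
  change φ (D.e v • g x) ≠ 0
  rwa [← map_smul, hex]

end TwoFiltrations

end LineData

/-! ## Powers of the radical -/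

section Radical

variable {A : Type} [Ring A]

theorem comp_mem_radSet {W X Y : ModuleCat.{0} A} (u : W ⟶ X) {g : X ⟶ Y}
    (hg : g ∈ radSet A X Y) : u ≫ g ∈ radSet A W Y := fun M hM h h' hi =>
  hg M hM (h ≫ u) h' (by simpa only [Category.assoc] using hi)

theorem comp_mem_radPowSet {m : ℕ} {X Y Z : ModuleCat.{0} A} [Module.Finite A Z] {f : X ⟶ Y}
    {g : Y ⟶ Z} (hf : f ∈ radPowSet A m X Y) (hg : g ∈ radSet A Y Z) :
    f ≫ g ∈ radPowSet A (m + 1) X Z := by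
  induction m generalizing X with
  | zero => exact ⟨Z, f ≫ g, 𝟙 Z, ‹_›, comp_mem_radSet f hg, trivial, (Category.comp_id _).symm⟩
  | succ m ih =>
    obtain ⟨M, g', h, hM, hg', hh, rfl⟩ := hf
    exact ⟨M, g', h ≫ g, hM, hg', ih hh, Category.assoc _ _ _⟩

theorem radPowSet_succ_subset (m : ℕ) (X Y : ModuleCat.{0} A) :
    radPowSet A (m + 1) X Y ⊆ radPowSet A m X Y := by
  induction m generalizing X with
  | zero => exact fun f _ => trivial
  | succ m ih =>
    rintro _ ⟨M, g, h, hM, hg, hh, rfl⟩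
    exact ⟨M, g, h, hM, hg, ih M hh, rfl⟩

theorem radPowSet_antitone (X Y : ModuleCat.{0} A) : Antitone fun m => radPowSet A m X Y :=
  antitone_nat_of_succ_le fun m => radPowSet_succ_subset m X Y

theorem Indec.comp_eq_id {X M : ModuleCat.{0} A} (hX : Indec A X) (hM : Nontrivial M) {i : M ⟶ X}
    {p : X ⟶ M} (h : i ≫ p = 𝟙 M) : p ≫ i = 𝟙 X := by
  refine (hX.2 (p ≫ i) ?_).resolve_left fun h0 => ?_
  · rw [Category.assoc, reassoc_of% h]
  · have h1 : 𝟙 M = 0 := by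
      calc 𝟙 M = i ≫ (p ≫ i) ≫ p := by rw [Category.assoc, reassoc_of% h, h]
        _ = 0 := by rw [h0, Limits.zero_comp, Limits.comp_zero]
    obtain ⟨x, hx⟩ := exists_ne (0 : M)
    exact hx (LinearMap.congr_fun (congrArg ModuleCat.Hom.hom h1) x)

/-- A morphism between indecomposable modules which is not an isomorphism is radical. -/
theorem mem_radSet_of_not_isIso {X Y : ModuleCat.{0} A} (hX : Indec A X) (hY : Indec A Y)
    {f : X ⟶ Y} (hf : ¬ IsIso f) : f ∈ radSet A X Y := by
  intro M hM h h' hi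
  have hh : IsIso h := by
    have h1 : h ≫ f ≫ h' ≫ inv (h ≫ f ≫ h') = 𝟙 M := by
      simpa only [Category.assoc] using IsIso.hom_inv_id (h ≫ f ≫ h')
    exact ⟨_, h1, hX.comp_eq_id hM.2.1 h1⟩
  have hh' : IsIso h' := by
    have h1 : (inv (h ≫ f ≫ h') ≫ h ≫ f) ≫ h' = 𝟙 M := by
      simpa only [Category.assoc] using IsIso.inv_hom_id (h ≫ f ≫ h')
    exact ⟨_, hY.comp_eq_id hM.2.1 h1, h1⟩
  have h2 : IsIso (f ≫ h') := IsIso.of_isIso_comp_left h (f ≫ h')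
  exact hf (IsIso.of_isIso_comp_right f h')

end Radical

namespace LineData

variable {k A : Type} [Field k] [Ring A] [Algebra k A] {n : ℕ} (D : LineData k A n)

section UpperBound

open scoped ModuleCat

theorem map_mem_of_mem_radSet {X Y : ModuleCat.{0} A} {g : X ⟶ Y} (hg : g ∈ radSet A X Y)
    {v r s : ℕ} (hv : v < n) (hr : r ≤ v) (hs : s ≤ n - 1 - v) {x : X}
    (hx : x ∈ D.leftFil X v (r + 1)) (hx' : x ∈ D.rightFil X v (s + 1)) :
    g.hom x ∈ D.leftFil Y v r ⊔ D.rightFil Y v s := by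
  by_contra hgx
  obtain ⟨p, q, hq, hpq, f, h, m, hm⟩ := D.exists_coord_ne_zero g.hom hv hr hs hx hx' hgx
  exact hg _ (Interval.finIndec (hq := hq) hpq) (ModuleCat.ofHom f) (ModuleCat.ofHom h)
    (Interval.isIso_of_coord_ne_zero _ (m := m) (j := v) hm)

theorem eq_zero_of_mem_radPowSet {v : ℕ} (hv : v < n) {m : ℕ} {X Y : ModuleCat.{0} A} {f : X ⟶ Y}
    (hf : f ∈ radPowSet A m X Y) {r s : ℕ} (hr : r ≤ v + 1) (hs : s ≤ n - v)
    (hrs : r + s ≤ m + 1) {x : X} (hx : x ∈ D.leftFil X v r) (hx' : x ∈ D.rightFil X v s) :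
    f.hom x = 0 := by
  induction m generalizing X r s with
  | zero =>
    have h0 : x = 0 := by
      rcases Nat.eq_zero_or_pos r with rfl | hr0
      · rwa [leftFil, lineFil_zero] at hx
      · obtain rfl : s = 0 := by omega
        rwa [rightFil, lineFil_zero] at hx'
    rw [h0, map_zero]
  | succ m ih =>
    obtain ⟨M, g, h, -, hg, hh, rfl⟩ := hf
    cases r with
    | zero =>
      rw [leftFil, lineFil_zero, Submodule.mem_bot] at hx
      rw [hx, map_zero]
    | succ r =>
      cases s with
      | zero =>
        rw [rightFil, lineFil_zero, Submodule.mem_bot] at hx'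
        rw [hx', map_zero]
      | succ s =>
        obtain ⟨y, hy, z, hz, hyz⟩ := Submodule.mem_sup.1
          (D.map_mem_of_mem_radSet hg hv (by omega) (by omega) hx hx')
        have hgl : g.hom x ∈ D.leftFil M v (r + 1) := map_mem_lineFil g.hom hx
        have hgr : g.hom x ∈ D.rightFil M v (s + 1) := map_mem_lineFil g.hom hx'
        have hy' : y ∈ D.rightFil M v (s + 1) := by
          rw [← hyz] at hgr
          exact (Submodule.add_mem_iff_left _ (lineFil_mono D.rev_tgt_mul _ _ hz)).1 hgr
        have hz' : z ∈ D.leftFil M v (r + 1) := by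
          rw [← hyz] at hgl
          exact (Submodule.add_mem_iff_right _ (lineFil_mono D.tgt_mul _ _ hy)).1 hgl
        change h.hom (g.hom x) = 0
        rw [← hyz, map_add, ih hh (by omega) (by omega) (by omega) hy hy',
          ih hh (by omega) (by omega) (by omega) hz' hz, add_zero]

theorem radVanishes (D : LineData k A n) : RadVanishes A n := by
  intro X Y _ _ f hf
  ext x
  change f.hom x = 0
  have hx : ∑ v ∈ Finset.range n, D.e v • x = x := by
    rw [← Finset.sum_smul, D.sum_e, one_smul]
  rw [← hx, map_sum]
  refine Finset.sum_eq_zero fun v hv => ?_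
  rw [Finset.mem_range] at hv
  have hfix : D.e v • x ∈ fixedSub k (D.e v) X := by
    rw [mem_fixedSub, smul_smul, D.e_mul_self]
  refine D.eq_zero_of_mem_radPowSet hv hf (r := v + 1) (s := n - v) le_rfl le_rfl (by omega) ?_ ?_
  · rwa [leftFil, lineFil_top D.tgt_mul]
  · rw [rightFil, show n - v = n - 1 - v + 1 by omega, lineFil_top D.rev_tgt_mul,
      D.revE_rev hv]
    exact hfix

end UpperBound

section LowerBound

theorem le_of_isIso {b c : ℕ} (hb : b < n) (hc : c < n)
    (f : ModuleCat.of A (D.Interval 0 b hb) ⟶ ModuleCat.of A (D.Interval 0 c hc)) [IsIso f] :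
    c ≤ b := by
  by_contra h
  obtain ⟨x, hx⟩ := ((ConcreteCategory.isIso_iff_bijective f).1 ‹_›).2 (Interval.single D hc c)
  have h1 : D.e c • (x : D.Interval 0 b hb) = 0 := by
    rw [Interval.e_smul, Interval.coord_of_notMem (by simpa using h), zero_smul]
  have h2 : D.e c • (Interval.single D hc c : D.Interval 0 c hc) = 0 := by
    rw [← hx]
    exact (f.hom.map_smul (D.e c) x).symm.trans ((congrArg f.hom h1).trans (map_zero _))
  have hcm : c ∈ Finset.Icc 0 c := by simp
  rw [Interval.e_smul, Interval.coord_single hcm, if_pos rfl, one_smul] at h2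
  exact Interval.single_ne_zero hcm h2

theorem exists_mem_radSet {b c : ℕ} (hb : b < n) (hc : c < n)
    (h : b < c ∧ D.o b = false ∨ c < b ∧ D.o c = true) :
    ∃ f : ModuleCat.of A (D.Interval 0 b hb) ⟶ ModuleCat.of A (D.Interval 0 c hc),
      f ∈ radSet A _ _ ∧ f.hom (Interval.single D hb 0) = Interval.single D hc 0 := by
  set y : ℕ → D.Interval 0 c hc := fun j => if j ≤ min b c then Interval.single D hc j else 0
    with hy
  have h1 : ∀ j ∈ Finset.Icc 0 b, D.e j • y j = y j := by
    intro j _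
    simp only [hy]
    split_ifs with hj
    · have hjm : j ∈ Finset.Icc 0 c := by
        rw [Finset.mem_Icc]; omega
      rw [Interval.e_smul, Interval.coord_single hjm, if_pos rfl, one_smul]
    · rw [smul_zero]
  have h2 : ∀ j ∉ Finset.Icc 0 b, y j = 0 := by
    intro j hj
    rw [Finset.mem_Icc] at hj
    exact if_neg (by omega)
  have h3 : ∀ l, l + 1 < n → lineSrc D.o l ∈ Finset.Icc 0 b →
      D.a l • y (lineSrc D.o l) = y (lineTgt D.o l) := by
    intro l hl hlb
    have hsc : ∀ {j}, j ≤ min b c → j ∈ Finset.Icc 0 c := fun hj => by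
      rw [Finset.mem_Icc]; omega
    rw [Finset.mem_Icc] at hlb
    simp only [hy]
    by_cases hs : lineSrc D.o l ≤ min b c
    · rw [if_pos hs, Interval.a_smul_single hl (hsc hs)]
      split_ifs with ht
      · rfl
      · refine Interval.ext_coord fun j hj => ?_
        rw [Finset.mem_Icc] at hj
        have hjt : j ≠ lineTgt D.o l := by
          rintro rfl
          rw [lineSrc] at hs
          rw [lineTgt] at ht hj
          split_ifs at * with ho
          · obtain rfl : l = b := by omega
            rcases h with h | h
            · rw [ho] at h; simp at h
            · omega
          · omega
        rw [Interval.coord_single (Finset.mem_Icc.2 hj), if_neg hjt, map_zero]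
    · rw [if_neg hs, smul_zero, if_neg]
      intro ht
      rw [lineSrc] at hs hlb
      rw [lineTgt] at ht
      split_ifs at * with ho
      · omega
      · obtain rfl : l = c := by omega
        rcases h with h | h
        · omega
        · exact ho h.2
  obtain ⟨f, hf⟩ := D.exists_hom_from_interval hb h1 h2 h3
  refine ⟨ModuleCat.ofHom f, mem_radSet_of_not_isIso (Interval.finIndec (Nat.zero_le b)).2
    (Interval.finIndec (Nat.zero_le c)).2 fun hi => ?_, ?_⟩
  · have h4 := D.le_of_isIso hb hc (ModuleCat.ofHom f)
    have h5 := D.le_of_isIso hc hb (inv (ModuleCat.ofHom f))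
    omega
  · change f _ = _
    have h0 : 0 ∈ Finset.Icc 0 b := by simp
    rw [hf, Finset.sum_eq_single 0 (fun j hj hj0 => ?_) (fun h => absurd h0 h)]
    · rw [Interval.coord_single h0, if_pos rfl, one_smul]
      exact if_pos (Nat.zero_le _)
    · rw [Interval.coord_single hj, if_neg hj0, zero_smul]

theorem exists_mem_radPowSet (d : ℕ) : ∀ b, b + d + 1 = n → ∃ (s t : ℕ) (hs : s < n) (ht : t < n)
    (f : ModuleCat.of A (D.Interval 0 s hs) ⟶ ModuleCat.of A (D.Interval 0 t ht)),
      b ≤ s ∧ b ≤ t ∧ f ∈ radPowSet A d _ _ ∧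
        f.hom (Interval.single D hs 0) = Interval.single D ht 0 := by
  induction d with
  | zero => exact fun b hb => ⟨b, b, by omega, by omega, 𝟙 _, le_rfl, le_rfl, trivial, rfl⟩
  | succ d ih =>
    intro b hb
    obtain ⟨s, t, hs, ht, f, hbs, hbt, hf, hf0⟩ := ih (b + 1) (by omega)
    have hbn : b < n := by omega
    cases ho : D.o b
    · obtain ⟨g, hg, hg0⟩ := D.exists_mem_radSet hbn hs (Or.inl ⟨hbs, ho⟩)
      refine ⟨b, t, hbn, ht, g ≫ f, le_rfl, (Nat.le_succ b).trans hbt,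
        ⟨_, g, f, (Interval.finIndec (Nat.zero_le s)).1, hg, hf, rfl⟩, ?_⟩
      change f.hom (g.hom _) = _
      rw [hg0, hf0]
    · obtain ⟨g, hg, hg0⟩ := D.exists_mem_radSet ht hbn (Or.inr ⟨hbt, ho⟩)
      have := (Interval.finIndec (D := D) (hq := hbn) (Nat.zero_le b)).1
      refine ⟨s, b, hs, hbn, f ≫ g, (Nat.le_succ b).trans hbs, le_rfl,
        comp_mem_radPowSet hf hg, ?_⟩
      change g.hom (f.hom _) = _
      rw [hf0, hg0]

theorem le_of_radVanishes (D : LineData k A n) {l : ℕ} (hl : RadVanishes A l) : n ≤ l := by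
  by_contra h
  obtain ⟨s, t, hs, ht, f, -, -, hf, hf0⟩ := D.exists_mem_radPowSet (n - 1) 0 (by omega)
  have h0 : f = 0 := hl _ _ (Interval.finIndec (Nat.zero_le s)).1
    (Interval.finIndec (Nat.zero_le t)).1 f (radPowSet_antitone _ _ (by omega) hf)
  rw [h0] at hf0
  exact Interval.single_ne_zero (Finset.left_mem_Icc.2 (Nat.zero_le t)) hf0.symm

end LowerBound

end LineData

/-- Theorem (Zacharia): if `H = kQ` is a representation-finite hereditary algebra whose
underlying graph is the Dynkin diagram `A_n` (`n ≥ 1`), then the nilpotency index of the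
radical of `mod H` equals `n`. -/
theorem nilpotency_index_hereditary_typeA (k A : Type) [Field k] [IsAlgClosed k] [Ring A] [Algebra k A]
    [FiniteDimensional k A] (V E : Type) [Fintype V] [Fintype E]
    (P : QuiverPresentation k A V E) (hadm : P.Admissible) (hmin : P.Minimal)
    (hher : Hereditary A) (hrf : RepFinite A)
    (n : ℕ) (hn : 1 ≤ n) (hgraph : P.GraphSpec n (n - 1) (typeAEnds n)) :
    NilpotencyIndex A n := by
  obtain ⟨D⟩ := P.exists_lineData hher n hgraph
  exact ⟨hn, D.radVanishes, fun _ => D.le_of_radVanishes⟩
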